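/- arXiv:math/9712251 — 2 statements merged into one kernel-verified Lean document; each statement's English description precedes it below -/
import Mathlib

section
/- Let i = √−1, let g(z, w) = (z − ((5−5i)/2)w + ((3−5i)/2)w̄) · (z − ((7−10i)/2)w + ((3−10i)/2)w̄) · (z − ((5−14i)/2)w − ((3+14i)/2)w̄) · (z − ((7−9i)/2)w − ((3+9i)/2)w̄) · (z − 6w), and let f_L(z, w) = g(z, w)·(z − ((6−7i)/2)w − ((3+14i)/2)w̄). Let f_M(z, w) = (z − (10−i)w + (9−4i)w̄) · (z − (3−4i)w − (1+4i)w̄) · (z − ((5−10i)/2)w + ((1−10i)/2)w̄) · (z − (6−5i)w + ((1−10i)/2)w̄) · (z − ((21−29i)/4)w + ((1−9i)/4)w̄) · (z − 6w). Let X_L = {(z, w) ∈ ℂ² : f_L(z, w) ≠ 0} and X_M = {(z, w) ∈ ℂ² : f_M(z, w) ≠ 0}, with the subspace topology. Then X_L and X_M are not homotopy equivalent. -/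
open Complex in
/-- The common degree-5 factor of the defining polynomials of Mazurovskiĭ's
arrangements `K` and `L`. -/
noncomputable def mazG (z w : ℂ) : ℂ :=
  (z - ((5 - 5 * I) / 2) * w + ((3 - 5 * I) / 2) * (starRingEnd ℂ) w) *
  (z - ((7 - 10 * I) / 2) * w + ((3 - 10 * I) / 2) * (starRingEnd ℂ) w) *
  (z - ((5 - 14 * I) / 2) * w - ((3 + 14 * I) / 2) * (starRingEnd ℂ) w) *
  (z - ((7 - 9 * I) / 2) * w - ((3 + 9 * I) / 2) * (starRingEnd ℂ) w) *
  (z - 6 * w)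

open Complex in
/-- Defining polynomial of Mazurovskiĭ's arrangement `L`. -/
noncomputable def mazFL (z w : ℂ) : ℂ :=
  mazG z w * (z - ((6 - 7 * I) / 2) * w - ((3 + 14 * I) / 2) * (starRingEnd ℂ) w)

open Complex in
/-- Defining polynomial of Mazurovskiĭ's arrangement `M`. -/
noncomputable def mazFM (z w : ℂ) : ℂ :=
  (z - (10 - I) * w + (9 - 4 * I) * (starRingEnd ℂ) w) *
  (z - (3 - 4 * I) * w - (1 + 4 * I) * (starRingEnd ℂ) w) *
  (z - ((5 - 10 * I) / 2) * w + ((1 - 10 * I) / 2) * (starRingEnd ℂ) w) *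
  (z - (6 - 5 * I) * w + ((1 - 10 * I) / 2) * (starRingEnd ℂ) w) *
  (z - ((21 - 29 * I) / 4) * w + ((1 - 9 * I) / 4) * (starRingEnd ℂ) w) *
  (z - 6 * w)


namespace Maz
open Complex Set Topology

/-- `F` has a continuous logarithm on `U`. -/
def HasLogOn {α : Type*} [TopologicalSpace α] (F : α → ℂ) (U : Set α) : Prop :=
  ∃ s : α → ℂ, ContinuousOn s U ∧ ∀ x ∈ U, exp (s x) = F x

lemma HL {Y : Type*} [TopologicalSpace Y] (H : unitInterval × Y → ℂ) (hc : Continuous H)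
    (h0 : ∀ p, H p ≠ 0) (s : Y → ℂ) (hs : Continuous s) (hs0 : ∀ y, exp (s y) = H (0, y)) :
    ∃ Λ : unitInterval × Y → ℂ, Continuous Λ ∧ (∀ p, exp (Λ p) = H p) ∧ ∀ y, Λ (0, y) = s y := by
  let H' : C(unitInterval × Y, {z : ℂ // z ≠ 0}) := ⟨fun p => ⟨H p, h0 p⟩, by fun_prop⟩
  have H_0 : ∀ a, H' (0, a) = (fun z : ℂ ↦ (⟨_, z.exp_ne_zero⟩ : {z : ℂ // z ≠ 0}))
    ((⟨s, hs⟩ : C(Y, ℂ)) a) := fun a => Subtype.ext (hs0 a).symm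
  refine ⟨isCoveringMap_exp.liftHomotopy H' ⟨s, hs⟩ H_0, by fun_prop, fun p => ?_, fun y => ?_⟩
  · exact congrArg Subtype.val (congrFun (isCoveringMap_exp.liftHomotopy_lifts H' ⟨s, hs⟩ H_0) p)
  · exact isCoveringMap_exp.liftHomotopy_zero H' ⟨s, hs⟩ H_0 y

/-- uniqueness of logs on a preconnected set -/
lemma UQ {α : Type*} [TopologicalSpace α] {U : Set α} (hU : IsPreconnected U) {s t : α → ℂ}
    (hs : ContinuousOn s U) (ht : ContinuousOn t U) (h : ∀ x ∈ U, exp (s x) = exp (t x)) :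
    ∃ n : ℤ, ∀ x ∈ U, s x = t x + n * (2 * Real.pi * I) := by
  rcases U.eq_empty_or_nonempty with rfl | ⟨x0, hx0⟩
  · exact ⟨0, by simp⟩
  choose! n hn using fun x hx => Complex.exp_eq_exp_iff_exists_int.1 (h x hx)
  have hc : ContinuousOn (fun x => (s x - t x) / (2 * Real.pi * I)) U := by fun_prop
  have hpi : (2 * Real.pi * I : ℂ) ≠ 0 := Complex.two_pi_I_ne_zero
  have hE : ∀ x ∈ U, (s x - t x) / (2 * Real.pi * I) = ((n x : ℝ) : ℂ) := by
    intro x hx; rw [hn x hx]; field_simp; push_cast; ring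
  have hc2 : ContinuousOn (fun x => (n x : ℝ)) U := by
    have := Complex.continuous_re.comp_continuousOn hc
    refine this.congr fun x hx => ?_
    simp only [Function.comp]
    rw [hE x hx]; simp
  have hc3 : ContinuousOn n U := by
    have he : IsEmbedding ((↑) : ℤ → ℝ) := Int.isClosedEmbedding_coe_real.isEmbedding
    exact he.continuousOn_iff.2 hc2
  refine ⟨n x0, fun x hx => ?_⟩
  rw [hn x hx, hU.constant hc3 hx hx0]

lemma hl_on {β : Type*} [TopologicalSpace β] {U : Set β} {G : ℝ × β → ℂ}
    (hG : ContinuousOn G (Icc 0 1 ×ˢ U)) (h0 : ∀ p ∈ (Icc (0:ℝ) 1 ×ˢ U), G p ≠ 0)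
    (h : HasLogOn (fun y => G (0, y)) U) : HasLogOn (fun y => G (1, y)) U := by
  classical
  obtain ⟨s, hs, hs0⟩ := h
  have hm : ∀ p : unitInterval × U, ((p.1 : ℝ), (p.2 : β)) ∈ Icc (0:ℝ) 1 ×ˢ U := fun p => ⟨p.1.2, p.2.2⟩
  obtain ⟨Λ, hΛ, h1, h2⟩ := HL (Y := U) (fun p => G (p.1, p.2))
    (hG.comp_continuous (by fun_prop) hm) (fun p => h0 _ (hm p)) (fun y => s y)
    (hs.comp_continuous (by fun_prop) fun x => x.2) (fun y => hs0 y y.2)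
  refine ⟨fun y => if hy : y ∈ U then Λ (1, ⟨y, hy⟩) else 0, ?_, fun x hx => ?_⟩
  · rw [continuousOn_iff_continuous_domRestrict]
    have : Continuous fun y : U => Λ (1, y) := by fun_prop
    convert this using 2 with y
    simp
  · simp only [hx, dif_pos]; exact h1 _

lemma star_log {E : Type*} [AddCommGroup E] [Module ℝ E] [TopologicalSpace E]
    [ContinuousAdd E] [ContinuousSMul ℝ E] {U : Set E} {x0 : E} (hU : StarConvex ℝ x0 U)
    {F : E → ℂ} (hF : ContinuousOn F U) (h0 : ∀ x ∈ U, F x ≠ 0) : HasLogOn F U := by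
  rcases U.eq_empty_or_nonempty with rfl | hne
  · exact ⟨0, by simp, by simp⟩
  have hx0 := hU.mem hne
  have hmem : ∀ p ∈ Icc (0:ℝ) 1 ×ˢ U, (1 - p.1) • x0 + p.1 • p.2 ∈ U := by
    rintro ⟨t, x⟩ ⟨⟨h1, h2⟩, hx⟩
    exact hU hx (by simpa using h2) h1 (by simp)
  have := hl_on (U := U) (G := fun p => F ((1 - p.1) • x0 + p.1 • p.2))
    (hF.comp (by fun_prop) hmem) (fun p hp => h0 _ (hmem p hp))
    ⟨fun _ => log (F x0), continuousOn_const, fun x _ => by simp [exp_log (h0 _ hx0)]⟩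
  simpa using this

/-- gluing -/
lemma glue_log {α : Type*} [TopologicalSpace α] {U V : Set α} (hU : IsOpen U) (hV : IsOpen V)
    (hUV : IsPreconnected (U ∩ V)) {F : α → ℂ} (h1 : HasLogOn F U) (h2 : HasLogOn F V) :
    HasLogOn F (U ∪ V) := by
  classical
  obtain ⟨s, hs, hs'⟩ := h1
  obtain ⟨t, ht, ht'⟩ := h2
  obtain ⟨n, hn⟩ := UQ hUV (hs.mono inter_subset_left) (ht.mono inter_subset_right)
    (fun x hx => (hs' x hx.1).trans (ht' x hx.2).symm)
  set r : α → ℂ := fun x => if x ∈ U then s x else t x + n * (2 * Real.pi * I) with hr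
  have hrU : ∀ x ∈ U, r x = s x := fun x hx => if_pos hx
  have hrV : ∀ x ∈ V, r x = t x + n * (2 * Real.pi * I) := by
    intro x hx
    by_cases hxU : x ∈ U
    · rw [hrU x hxU, hn x ⟨hxU, hx⟩]
    · exact if_neg hxU
  refine ⟨r, ?_, ?_⟩
  · refine ContinuousOn.union_of_isOpen (hs.congr hrU) ((ht.add continuousOn_const).congr hrV) hU hV
  · rintro x (hx | hx)
    · rw [hrU x hx, hs' x hx]
    · rw [hrV x hx, Complex.exp_add, Complex.exp_int_mul_two_pi_mul_I, mul_one, ht' x hx]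

end Maz

namespace Maz
open Complex Set Topology

lemma one_puncture {D : Set ℂ} (hD : Convex ℝ D) {s : ℂ} {ρ : ℝ} (hρ : 0 < ρ)
    (hb : Metric.sphere s ρ ⊆ D) {F : ℂ → ℂ} (hF : ContinuousOn F (D \ {s}))
    (h0 : ∀ x ∈ D \ {s}, F x ≠ 0) (h : HasLogOn F (Metric.sphere s ρ)) :
    HasLogOn F (D \ {s}) := by
  have hn : ∀ v ∈ D \ {s}, 0 < ‖v - s‖ := fun v hv => norm_pos_iff.2 (sub_ne_zero.2 hv.2)
  have hsph : ∀ v ∈ D \ {s}, s + (ρ / ‖v - s‖) • (v - s) ∈ Metric.sphere s ρ := by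
    intro v hv
    have := hn v hv
    rw [mem_sphere_iff_norm, add_sub_cancel_left, norm_smul, Real.norm_of_nonneg (by positivity)]
    field_simp
  have hmem : ∀ p ∈ Icc (0:ℝ) 1 ×ˢ (D \ {s}),
      (1 - p.1) • (s + (ρ / ‖p.2 - s‖) • (p.2 - s)) + p.1 • p.2 ∈ D \ {s} := by
    rintro ⟨t, v⟩ ⟨⟨h1, h2⟩, hv⟩
    simp only at h1 h2 hv ⊢
    refine ⟨hD (hb (hsph v hv)) hv.1 (by linarith) h1 (by ring), fun he => ?_⟩
    have hpos := hn v hv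
    have hco : 0 < (1 - t) * (ρ / ‖v - s‖) + t := by
      rcases h1.eq_or_lt with rfl | h1
      · simp; positivity
      · have : 0 ≤ (1 - t) * (ρ / ‖v - s‖) := mul_nonneg (by linarith) (by positivity)
        linarith
    have h3 : (1 - t) • (s + (ρ / ‖v - s‖) • (v - s)) + t • v
        = s + ((1 - t) * (ρ / ‖v - s‖) + t) • (v - s) := by
      simp only [Complex.real_smul]; push_cast; ring
    rw [mem_singleton_iff, h3, add_eq_left, smul_eq_zero] at he
    rcases he with he | he
    · exact hco.ne' he
    · exact hv.2 (sub_eq_zero.1 he)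
  have hcont : ContinuousOn (fun v : ℂ => s + (ρ / ‖v - s‖) • (v - s)) (D \ {s}) := by
    have : ∀ v ∈ D \ {s}, ‖v - s‖ ≠ 0 := fun v hv => (hn v hv).ne'
    fun_prop (disch := assumption)
  have := hl_on (U := D \ {s})
    (G := fun p => F ((1 - p.1) • (s + (ρ / ‖p.2 - s‖) • (p.2 - s)) + p.1 • p.2))
    (hF.comp (by
      have h2 : ContinuousOn (fun p : ℝ × ℂ => s + (ρ / ‖p.2 - s‖) • (p.2 - s))
        (Icc (0:ℝ) 1 ×ˢ (D \ {s})) := hcont.comp continuousOn_snd fun p hp => hp.2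
      fun_prop) hmem) (fun p hp => h0 _ (hmem p hp))
    (by
      obtain ⟨l, hl, hl'⟩ := h
      refine ⟨fun v => l (s + (ρ / ‖v - s‖) • (v - s)), hl.comp hcont hsph, fun v hv => ?_⟩
      rw [hl' _ (hsph v hv)]; simp)
  simpa using this

lemma multi_puncture_aux (n : ℕ) : ∀ (D : Set ℂ) (_ : Convex ℝ D) (_ : IsOpen D) (S : Finset ℂ)
    (_ : (S : Set ℂ) ⊆ D) (_ : S.card ≤ n)
    (F : ℂ → ℂ) (_ : ContinuousOn F (D \ S)) (_ : ∀ x ∈ D \ (S : Set ℂ), F x ≠ 0)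
    (_ : ∀ s ∈ S, ∃ ρ0 > 0, ∀ ρ, 0 < ρ → ρ ≤ ρ0 → HasLogOn F (Metric.sphere s ρ)),
    HasLogOn F (D \ S) := by
  classical
  induction n with
  | zero =>
    intro D hD hDo S hS hc F hF h0 h
    have : S = ∅ := by simpa using hc
    subst this
    rcases D.eq_empty_or_nonempty with rfl | ⟨x, hx⟩
    · exact ⟨0, by simp, by simp⟩
    simp only [Finset.coe_empty, sdiff_empty] at *
    exact star_log (hD.starConvex hx) hF h0
  | succ n ih =>
    intro D hD hDo S hS hc F hF h0 h
    by_cases hsub : S.card ≤ n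
    · exact ih D hD hDo S hS hsub F hF h0 h
    rcases Nat.lt_or_ge 1 S.card with h1 | h1
    swap
    · obtain ⟨s, rfl⟩ := Finset.card_eq_one.1 (show S.card = 1 by omega)
      obtain ⟨ρ0, hρ0, hl⟩ := h s (by simp)
      have hsD : s ∈ D := hS (by simp)
      obtain ⟨r, hr, hrD⟩ := Metric.nhds_basis_closedBall.mem_iff.1 (hDo.mem_nhds hsD)
      rw [Finset.coe_singleton] at *
      exact one_puncture hD (ρ := min r ρ0) (lt_min hr hρ0)
        ((Metric.sphere_subset_closedBall.trans
          (Metric.closedBall_subset_closedBall (min_le_left _ _))).trans hrD) hF h0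
        (hl _ (lt_min hr hρ0) (min_le_right _ _))
    · obtain ⟨s', hs', t', ht', hne⟩ := Finset.one_lt_card.1 h1
      have : ∃ ℓ : ℂ →L[ℝ] ℝ, ∃ s ∈ S, ∃ t ∈ S, ℓ s < ℓ t := by
        rcases lt_trichotomy s'.re t'.re with hlt | heq | hlt
        · exact ⟨reCLM, s', hs', t', ht', hlt⟩
        · rcases lt_trichotomy s'.im t'.im with hlt | heq' | hlt
          · exact ⟨imCLM, s', hs', t', ht', hlt⟩
          · exact absurd (Complex.ext heq heq') hne
          · exact ⟨imCLM, t', ht', s', hs', hlt⟩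
        · exact ⟨reCLM, t', ht', s', hs', hlt⟩
      obtain ⟨ℓ, s, hs, t, ht, hst⟩ := this
      obtain ⟨r, hr, hrmax⟩ := Finset.exists_max_image (S.filter fun x => ℓ x < ℓ t) ℓ
        ⟨s, by simp [hs, hst]⟩
      simp only [Finset.mem_filter] at hr hrmax
      have key : ∀ (E : Set ℂ) (_ : Convex ℝ E) (_ : IsOpen E), (∃ x ∈ S, x ∉ E) →
          HasLogOn F ((D ∩ E) \ S) := by
        rintro E hE hEo ⟨x, hxS, hxE⟩
        have hSE : (D ∩ E) \ (S : Set ℂ) = (D ∩ E) \ ((S.filter (· ∈ E) : Finset ℂ) : Set ℂ) := by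
          ext y; simp; tauto
        have hsubs : (D ∩ E) \ (S : Set ℂ) ⊆ D \ S := sdiff_subset_sdiff_left inter_subset_left
        have hFm := hF.mono hsubs
        have h0m : ∀ x ∈ (D ∩ E) \ (S : Set ℂ), F x ≠ 0 := fun x hx => h0 x (hsubs hx)
        rw [hSE] at hFm h0m ⊢
        refine ih (D ∩ E) (hD.inter hE) (hDo.inter hEo) _ ?_ ?_ F hFm h0m ?_
        · intro y hy
          simp only [Finset.coe_filter, mem_ofPred_eq] at hy
          exact ⟨hS hy.1, hy.2⟩
        · have : (S.filter (· ∈ E)).card < S.card :=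
            Finset.card_lt_card (Finset.filter_ssubset.2 ⟨x, hxS, hxE⟩)
          omega
        · intro y hy
          exact h y (Finset.mem_filter.1 hy).1
      have c1 : Convex ℝ {x | ℓ x < ℓ t} := convex_halfSpace_lt ℓ.isLinear _
      have c2 : Convex ℝ {x | ℓ r < ℓ x} := convex_halfSpace_gt ℓ.isLinear _
      have o1 : IsOpen {x | ℓ x < ℓ t} := isOpen_lt (by fun_prop) (by fun_prop)
      have o2 : IsOpen {x | ℓ r < ℓ x} := isOpen_lt (by fun_prop) (by fun_prop)
      have L1 := key _ c1 o1 ⟨t, ht, by simp⟩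
      have L2 := key _ c2 o2 ⟨r, hr.1, by simp⟩
      have hSc : IsClosed (S : Set ℂ) := S.finite_toSet.isClosed
      have G := glue_log ((hDo.inter o1).sdiff hSc) ((hDo.inter o2).sdiff hSc) (F := F) ?_ L1 L2
      · convert G using 1
        ext x
        simp only [mem_sdiff, mem_union, mem_inter_iff, mem_ofPred_eq]
        have : ℓ x < ℓ t ∨ ℓ r < ℓ x := by
          rcases lt_or_ge (ℓ x) (ℓ t) with h | h
          · exact .inl h
          · exact .inr (hr.2.trans_le h)
        tauto
      · have : (D ∩ {x | ℓ x < ℓ t}) \ (S : Set ℂ) ∩ ((D ∩ {x | ℓ r < ℓ x}) \ S)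
            = D ∩ {x | ℓ x < ℓ t} ∩ {x | ℓ r < ℓ x} := by
          ext x
          simp only [mem_sdiff, mem_inter_iff, mem_ofPred_eq]
          constructor
          · tauto
          · rintro ⟨⟨h1, h2⟩, h3⟩
            have : x ∉ (S : Set ℂ) := fun hx => absurd (hrmax x ⟨hx, h2⟩) (not_le.2 h3)
            tauto
        rw [this]
        exact ((hD.inter c1).inter c2).isPreconnected

lemma multi_puncture (S : Finset ℂ)
    (F : ℂ → ℂ) (hF : ContinuousOn F (S : Set ℂ)ᶜ) (h0 : ∀ x ∈ (S : Set ℂ)ᶜ, F x ≠ 0)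
    (h : ∀ s ∈ S, ∃ ρ0 > 0, ∀ ρ, 0 < ρ → ρ ≤ ρ0 → HasLogOn F (Metric.sphere s ρ)) :
    HasLogOn F (S : Set ℂ)ᶜ := by
  rw [compl_eq_univ_sdiff] at *
  exact multi_puncture_aux S.card univ convex_univ isOpen_univ S (subset_univ _) le_rfl F hF h0 h

end Maz

namespace Maz
open Complex Set Topology

lemma log_near {α : Type*} [TopologicalSpace α] {f g : α → ℂ} (hf : Continuous f)
    (hg : Continuous g) (h : ∀ x, ‖f x - g x‖ < ‖g x‖) :
    Continuous (fun x => log (f x / g x)) ∧ (∀ x, f x = g x * exp (log (f x / g x))) ∧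
      ∀ x, f x ≠ 0 := by
  have hg0 : ∀ x, g x ≠ 0 := fun x hx => by
    have := h x; rw [hx, norm_zero] at this; exact absurd this (not_lt.2 (norm_nonneg _))
  have hf0 : ∀ x, f x ≠ 0 := fun x hx => by
    have := h x; rw [hx, zero_sub, norm_neg] at this; exact absurd this (lt_irrefl _)
  have hs : ∀ x, f x / g x ∈ slitPlane := by
    intro x
    have h2 : f x / g x - 1 = (f x - g x) / g x := by field_simp [hg0 x]
    have h3 : ‖f x / g x - 1‖ < 1 := by
      rw [h2, norm_div, div_lt_one (norm_pos_iff.2 (hg0 x))]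
      exact h x
    simpa using Complex.mem_slitPlane_of_norm_lt_one h3
  refine ⟨?_, fun x => ?_, hf0⟩
  · exact (hf.div hg hg0).clog hs
  · rw [exp_log (div_ne_zero (hf0 x) (hg0 x)), mul_div_cancel₀ _ (hg0 x)]

lemma near_id {Ψ : ℂ → ℂ} (hΨ : Continuous Ψ) {C : ℝ} (hC : ∀ ζ, ‖Ψ ζ - ζ‖ ≤ C) :
    ∃ ζ, Ψ ζ = 0 := by
  by_contra! hne
  obtain ⟨h, hh, he⟩ := star_log (U := univ) (x0 := (0:ℂ)) (starConvex_univ _) hΨ.continuousOn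
    (fun x _ => hne x)
  have hC0 : 0 ≤ C := (norm_nonneg _).trans (hC 0)
  have hR0 : 0 < C + 1 := by linarith
  let e : ℝ → ℂ := fun φ => ((C + 1 : ℝ) : ℂ) * exp (φ * I)
  have hec : Continuous e := by fun_prop
  have hen : ∀ φ, ‖e φ‖ = C + 1 := fun φ => by
    simp [e, -ofReal_add, norm_exp_ofReal_mul_I, abs_of_pos hR0]
  obtain ⟨l1, l2, -⟩ := log_near (f := fun φ => Ψ (e φ)) (g := e) (hΨ.comp hec) hec
    (fun φ => by rw [hen]; linarith [hC (e φ)])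
  obtain ⟨n, hn⟩ := UQ (U := (univ : Set ℝ)) isPreconnected_univ (s := fun φ => h (e φ))
    (t := fun φ => log (Ψ (e φ) / e φ) + (Real.log (C + 1) + φ * I))
    ((continuousOn_univ.1 hh).comp hec).continuousOn (by fun_prop) (fun φ _ => by
      rw [he _ trivial, exp_add, exp_add, ← ofReal_exp, Real.exp_log hR0]
      exact (l2 φ).trans (mul_comm _ _))
  have e0 : e (2 * Real.pi) = e 0 := by simp [e]
  have h1 := hn 0 trivial
  have h2 := hn (2 * Real.pi) trivial
  simp only [e0] at h1 h2
  rw [h1] at h2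
  have : (2 * Real.pi * I : ℂ) = 0 := by
    push_cast at h2
    linear_combination -h2
  exact Complex.two_pi_I_ne_zero this

/-- doubly periodic continuous map, i.e. a torus in `Y` -/
def Dper {Y : Type*} [TopologicalSpace Y] (T : ℝ × ℝ → Y) : Prop :=
  Continuous T ∧ (∀ x y, T (x + 1, y) = T (x, y)) ∧ (∀ x y, T (x, y + 1) = T (x, y))

/-- winding numbers of a doubly periodic nonvanishing function -/
def Per (T : ℝ × ℝ → ℂ) (m n : ℤ) : Prop :=
  ∃ s : ℝ × ℝ → ℂ, Continuous s ∧ (∀ p, exp (s p) = T p) ∧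
    (∀ x y, s (x + 1, y) = s (x, y) + m * (2 * Real.pi * I)) ∧
    (∀ x y, s (x, y + 1) = s (x, y) + n * (2 * Real.pi * I))

lemma Dper.comp {Y Z : Type*} [TopologicalSpace Y] [TopologicalSpace Z] {T : ℝ × ℝ → Y}
    (h : Dper T) {f : Y → Z} (hf : Continuous f) : Dper (fun p => f (T p)) :=
  ⟨hf.comp h.1, fun x y => by simp only [h.2.1 x y], fun x y => by simp only [h.2.2 x y]⟩

lemma Per.exists {T : ℝ × ℝ → ℂ} (h : Dper T) (h0 : ∀ p, T p ≠ 0) : ∃ m n, Per T m n := by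
  obtain ⟨s, hs, he⟩ := star_log (U := univ) (x0 := (0 : ℝ × ℝ)) (starConvex_univ _) h.1.continuousOn
    (fun x _ => h0 x)
  rw [continuousOn_univ] at hs
  obtain ⟨m, hm⟩ := UQ (U := (univ : Set (ℝ × ℝ))) isPreconnected_univ
    (s := fun p => s (p.1 + 1, p.2)) (t := s) (by fun_prop) (by fun_prop)
    (fun p _ => by rw [he _ trivial, he _ trivial, h.2.1])
  obtain ⟨n, hn⟩ := UQ (U := (univ : Set (ℝ × ℝ))) isPreconnected_univ
    (s := fun p => s (p.1, p.2 + 1)) (t := s) (by fun_prop) (by fun_prop)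
    (fun p _ => by rw [he _ trivial, he _ trivial, h.2.2])
  exact ⟨m, n, s, hs, fun p => he p trivial, fun x y => hm (x, y) trivial,
    fun x y => hn (x, y) trivial⟩

lemma Per.unique {T : ℝ × ℝ → ℂ} {m n m' n' : ℤ} (h : Per T m n) (h' : Per T m' n') :
    m = m' ∧ n = n' := by
  obtain ⟨s, hs, he, h1, h2⟩ := h
  obtain ⟨s', hs', he', h1', h2'⟩ := h'
  obtain ⟨k, hk⟩ := UQ (U := (univ : Set (ℝ × ℝ))) isPreconnected_univ
    (s := s) (t := s') (by fun_prop) (by fun_prop) (fun p _ => by rw [he, he'])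
  have hpi := Complex.two_pi_I_ne_zero
  have a := h1 0 0
  have b := h2 0 0
  rw [hk _ trivial, hk _ trivial] at a b
  rw [h1'] at a
  rw [h2'] at b
  constructor
  · have : (m' : ℂ) = m := mul_right_cancel₀ hpi (by linear_combination a)
    exact_mod_cast this.symm
  · have : (n' : ℂ) = n := mul_right_cancel₀ hpi (by linear_combination b)
    exact_mod_cast this.symm

lemma Per.mul {S T : ℝ × ℝ → ℂ} {m n m' n' : ℤ} (h : Per S m n) (h' : Per T m' n') :
    Per (fun p => S p * T p) (m + m') (n + n') := by
  obtain ⟨s, hs, he, h1, h2⟩ := h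
  obtain ⟨s', hs', he', h1', h2'⟩ := h'
  refine ⟨fun p => s p + s' p, by fun_prop, fun p => by rw [exp_add, he, he'], fun x y => ?_,
    fun x y => ?_⟩
  · simp only [h1, h1']; push_cast; ring
  · simp only [h2, h2']; push_cast; ring

lemma Per.zpow {S : ℝ × ℝ → ℂ} {m n : ℤ} (h : Per S m n) (k : ℤ) :
    Per (fun p => S p ^ k) (k * m) (k * n) := by
  obtain ⟨s, hs, he, h1, h2⟩ := h
  refine ⟨fun p => k * s p, by fun_prop, fun p => by rw [exp_int_mul, he], fun x y => ?_,
    fun x y => ?_⟩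
  · simp only [h1]; push_cast; ring
  · simp only [h2]; push_cast; ring

lemma Per.of_exp {h : ℝ × ℝ → ℂ} (hh : Dper h) : Per (fun p => exp (h p)) 0 0 :=
  ⟨h, hh.1, fun _ => rfl, fun x y => by simp [hh.2.1], fun x y => by simp [hh.2.2]⟩

lemma Dper.const {Y : Type*} [TopologicalSpace Y] (c : Y) : Dper (fun _ : ℝ × ℝ => c) :=
  ⟨continuous_const, fun _ _ => rfl, fun _ _ => rfl⟩

lemma Per.const {c : ℂ} (hc : c ≠ 0) : Per (fun _ => c) 0 0 := by
  have := Per.of_exp (Dper.const (log c))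
  simpa [exp_log hc] using this

lemma Per.prod {ι : Type*} (A : Finset ι) {S : ι → ℝ × ℝ → ℂ} {m n : ι → ℤ}
    (h : ∀ i, Per (S i) (m i) (n i)) (k : ι → ℤ) :
    Per (fun p => ∏ i ∈ A, S i p ^ k i) (∑ i ∈ A, k i * m i) (∑ i ∈ A, k i * n i) := by
  classical
  induction A using Finset.induction_on with
  | empty => simpa using Per.const one_ne_zero
  | insert i A hi ih =>
    simp only [Finset.sum_insert hi, Finset.prod_insert hi]
    exact ((h i).zpow (k i)).mul ih

lemma Per.conj {S : ℝ × ℝ → ℂ} {m n : ℤ} (h : Per S m n) :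
    Per (fun p => (starRingEnd ℂ) (S p)) (-m) (-n) := by
  obtain ⟨s, hs, he, h1, h2⟩ := h
  refine ⟨fun p => (starRingEnd ℂ) (s p), by fun_prop, fun p => by rw [exp_conj, he],
    fun x y => ?_, fun x y => ?_⟩
  · simp only [h1, map_add, map_mul, map_ofNat, conj_I, conj_ofReal, map_intCast]; push_cast; ring
  · simp only [h2, map_add, map_mul, map_ofNat, conj_I, conj_ofReal, map_intCast]; push_cast; ring

lemma Per.near {f g : ℝ × ℝ → ℂ} {m n : ℤ} (hg : Per g m n) (hgd : Dper g) (hf : Dper f)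
    (h : ∀ x, ‖f x - g x‖ < ‖g x‖) : Per f m n := by
  obtain ⟨l1, l2, l3⟩ := log_near hf.1 hgd.1 h
  have := hg.mul (Per.of_exp (h := fun p => log (f p / g p))
    ⟨l1, fun x y => by simp only [hf.2.1, hgd.2.1], fun x y => by simp only [hf.2.2, hgd.2.2]⟩)
  simp only [add_zero, ← l2] at this
  exact this

lemma Per.ne {f : ℝ × ℝ → ℂ} {m n : ℤ} (hg : Per f m n) : ∀ p, f p ≠ 0 := by
  obtain ⟨s, -, h, -⟩ := hg
  exact fun p => h p ▸ exp_ne_zero _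

lemma Per.affine {f : ℝ × ℝ → ℂ} {m n : ℤ} (hf : Per f m n) (hd : Dper f) {α β : ℂ} {σ : ℤ}
    (hσ : (‖β‖ < ‖α‖ ∧ σ = 1) ∨ (‖α‖ < ‖β‖ ∧ σ = -1)) :
    Per (fun p => α * f p + β * (starRingEnd ℂ) (f p)) (σ * m) (σ * n) := by
  have hD : Dper (fun p => α * f p + β * (starRingEnd ℂ) (f p)) :=
    hd.comp (f := fun z => α * z + β * (starRingEnd ℂ) z) (by fun_prop)
  have hpos : ∀ p, 0 < ‖f p‖ := fun p => norm_pos_iff.2 (hf.ne p)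
  rcases hσ with ⟨h, rfl⟩ | ⟨h, rfl⟩
  · have hα : α ≠ 0 := norm_pos_iff.1 ((norm_nonneg _).trans_lt h)
    have h1 := (Per.const hα).mul hf
    simp only [zero_add] at h1
    simp only [one_mul]
    refine h1.near (hd.comp (f := fun z => α * z) (by fun_prop)) hD fun p => ?_
    simp only [add_sub_cancel_left, norm_mul, Complex.norm_conj]
    exact mul_lt_mul_of_pos_right h (hpos p)
  · have hα : β ≠ 0 := norm_pos_iff.1 ((norm_nonneg _).trans_lt h)
    have h1 := (Per.const hα).mul hf.conj
    simp only [zero_add] at h1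
    simp only [neg_mul, one_mul]
    refine h1.near (hd.comp (f := fun z => β * (starRingEnd ℂ) z) (by fun_prop)) hD fun p => ?_
    simp only [add_sub_cancel_right, norm_mul, Complex.norm_conj]
    exact mul_lt_mul_of_pos_right h (hpos p)

lemma Dper.bdd {g : ℝ × ℝ → ℝ} (hg : Dper g) : ∃ C, ∀ p, |g p| ≤ C := by
  have hz1 : ∀ (n : ℤ) x y, g (x + n, y) = g (x, y) := by
    intro n
    induction n using Int.induction_on with
    | zero => simp
    | succ n ih => intro x y; push_cast at ih ⊢; rw [← add_assoc, hg.2.1, ih]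
    | pred n ih =>
      intro x y; push_cast at ih ⊢
      rw [← ih x y, ← hg.2.1]; congr 2; ring
  have hz2 : ∀ (n : ℤ) x y, g (x, y + n) = g (x, y) := by
    intro n
    induction n using Int.induction_on with
    | zero => simp
    | succ n ih => intro x y; push_cast at ih ⊢; rw [← add_assoc, hg.2.2, ih]
    | pred n ih =>
      intro x y; push_cast at ih ⊢
      rw [← ih x y, ← hg.2.2]; congr 2; ring
  obtain ⟨C, hC⟩ := ((isCompact_Icc (a := (0:ℝ)) (b := 1)).prod
    (isCompact_Icc (a := (0:ℝ)) (b := 1))).exists_bound_of_continuousOn hg.1.continuousOn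
  refine ⟨C, fun ⟨x, y⟩ => ?_⟩
  have := hC (Int.fract x, Int.fract y)
    ⟨⟨Int.fract_nonneg _, (Int.fract_lt_one _).le⟩, ⟨Int.fract_nonneg _, (Int.fract_lt_one _).le⟩⟩
  rw [← hz1 ⌊x⌋, ← hz2 ⌊y⌋, Int.fract_add_floor, Int.fract_add_floor] at this
  exact this

lemma sum_one {F G : ℝ × ℝ → ℂ} {m n m' n' : ℤ} (hF : Per F m n) (hG : Per G m' n')
    (h : ∀ p, F p + G p = 1) : m * n' = n * m' := by
  by_contra hne
  obtain ⟨s, hs, hse, hs1, hs2⟩ := hF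
  obtain ⟨t, ht, hte, ht1, ht2⟩ := hG
  have hpi := Real.pi_pos
  obtain ⟨D, hD⟩ : ∃ D : ℝ, D = m * n' - n * m' := ⟨_, rfl⟩
  have hD0 : D ≠ 0 := by rw [hD, sub_ne_zero]; exact_mod_cast hne
  have bd : ∀ (s : ℝ × ℝ → ℂ) (m n : ℤ), Continuous s →
      (∀ x y, s (x + 1, y) = s (x, y) + m * (2 * Real.pi * I)) →
      (∀ x y, s (x, y + 1) = s (x, y) + n * (2 * Real.pi * I)) →
      ∃ C, ∀ p : ℝ × ℝ, |((s p).im / (2 * Real.pi) - 1 / 4) - (m * p.1 + n * p.2)| ≤ C := by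
    intro s m n hs h1 h2
    apply Dper.bdd (g := fun p => ((s p).im / (2 * Real.pi) - 1 / 4) - (m * p.1 + n * p.2))
    refine ⟨by fun_prop, fun x y => ?_, fun x y => ?_⟩
    · simp only [h1]; simp; field_simp; ring
    · simp only [h2]; simp; field_simp; ring
  obtain ⟨C1, hC1⟩ := bd s m n hs hs1 hs2
  obtain ⟨C2, hC2⟩ := bd t m' n' ht ht1 ht2
  let q : ℂ → ℝ × ℝ := fun ζ => ((n' * ζ.re - n * ζ.im) / D, (-m' * ζ.re + m * ζ.im) / D)
  have hq : Continuous q := by fun_prop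
  obtain ⟨ζ, hζ⟩ := near_id (C := C1 + C2) (Ψ := fun ζ =>
    (((s (q ζ)).im / (2 * Real.pi) - 1 / 4 : ℝ) : ℂ)
      + (((t (q ζ)).im / (2 * Real.pi) - 1 / 4 : ℝ) : ℂ) * I) (by fun_prop) (fun ζ => by
    refine (Complex.norm_le_abs_re_add_abs_im _).trans (add_le_add ?_ ?_)
    · refine le_of_eq_of_le (congrArg _ ?_) (hC1 (q ζ))
      simp only [sub_re, add_re, ofReal_re, mul_re, I_re, I_im, ofReal_im]
      have : (m : ℝ) * (q ζ).1 + n * (q ζ).2 = ζ.re := by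
        simp only [q]; field_simp; rw [hD]; ring
      rw [this]; ring
    · refine le_of_eq_of_le (congrArg _ ?_) (hC2 (q ζ))
      simp only [sub_im, add_im, ofReal_re, mul_im, I_re, I_im, ofReal_im]
      have : (m' : ℝ) * (q ζ).1 + n' * (q ζ).2 = ζ.im := by
        simp only [q]; field_simp; rw [hD]; ring
      rw [this]; ring)
  have e1 : (s (q ζ)).im = Real.pi / 2 := by
    have := congrArg re hζ
    simp only [zero_re, add_re, ofReal_re, mul_re, I_re, I_im, ofReal_im] at this
    field_simp at this
    linarith
  have e2 : (t (q ζ)).im = Real.pi / 2 := by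
    have := congrArg im hζ
    simp only [zero_im, add_im, ofReal_re, mul_im, I_re, I_im, ofReal_im] at this
    field_simp at this
    linarith
  have := congrArg re (h (q ζ))
  rw [← hse, ← hte, add_re, exp_re, exp_re, e1, e2] at this
  simp at this

end Maz

namespace Maz
open Complex Set Topology

lemma HasLogOn.comp {α β : Type*} [TopologicalSpace α] [TopologicalSpace β] {F : α → ℂ} {U : Set α}
    (h : HasLogOn F U) {g : β → α} {V : Set β} (hg : ContinuousOn g V) (hm : MapsTo g V U) :
    HasLogOn (fun x => F (g x)) V := by
  obtain ⟨s, hs, he⟩ := h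
  exact ⟨fun x => s (g x), hs.comp hg hm, fun x hx => he _ (hm hx)⟩

lemma HasLogOn.congr {α : Type*} [TopologicalSpace α] {F G : α → ℂ} {U : Set α}
    (h : HasLogOn F U) (hg : ∀ x ∈ U, G x = F x) : HasLogOn G U := by
  obtain ⟨s, hs, he⟩ := h
  exact ⟨s, hs, fun x hx => by rw [he x hx, hg x hx]⟩

lemma descend {g : ℂ → ℂ} {s : ℝ → ℂ} (hs : Continuous s) (hp : ∀ x, s (x + 1) = s x)
    (he : ∀ x : ℝ, exp (s x) = g (exp (2 * Real.pi * x * I))) :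
    HasLogOn g (Metric.sphere 0 1) := by
  have hpi := Real.pi_pos
  have hper : Function.Periodic (fun θ : ℝ => s (θ / (2 * Real.pi))) (2 * Real.pi) := by
    intro θ
    simp only
    rw [← hp (θ / (2 * Real.pi))]
    congr 1
    field_simp
  have hc : Continuous hper.lift := by
    apply continuous_coinduced_dom.2
    change Continuous (fun θ : ℝ => s (θ / (2 * Real.pi)))
    fun_prop
  refine ⟨fun z => hper.lift ((arg z : ℝ) : Real.Angle), ?_, ?_⟩
  · intro z hz
    have hz0 : z ≠ 0 := by rintro rfl; simp at hz
    exact (hc.continuousAt.comp (continuousAt_arg_coe_angle hz0)).continuousWithinAt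
  · intro z hz
    have h1 : hper.lift ((arg z : ℝ) : Real.Angle) = s (arg z / (2 * Real.pi)) :=
      Function.Periodic.lift_coe hper _
    refine (congrArg exp h1).trans ?_
    rw [he]
    congr 1
    have h2 : (2 * Real.pi * ((arg z / (2 * Real.pi) : ℝ) : ℂ) * I) = arg z * I := by
      have : (Real.pi : ℂ) ≠ 0 := by exact_mod_cast hpi.ne'
      push_cast; field_simp
    rw [h2]
    have := norm_mul_exp_arg_mul_I z
    rw [mem_sphere_zero_iff_norm.1 hz] at this
    simpa using this

/-- the total space step -/
lemma total {X : Set (ℂ × ℂ)} (hX : IsOpen X) (sec : ℂ → ℂ) (hsec : Continuous sec)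
    (hsm : ∀ w, (sec w, w) ∈ X) (hpc : ∀ w, IsPathConnected {z | (z, w) ∈ X})
    {F : ℂ × ℂ → ℂ} (hF : ContinuousOn F X) (h0 : ∀ p ∈ X, F p ≠ 0)
    (hfib : ∀ w, HasLogOn (fun z => F (z, w)) {z | (z, w) ∈ X}) : HasLogOn F X := by
  obtain ⟨σ, hσ, hσe⟩ := star_log (U := univ) (x0 := (0 : ℂ)) (F := fun w => F (sec w, w))
    (starConvex_univ _) (hF.comp (by fun_prop) (fun w _ => hsm w)) (fun w _ => h0 _ (hsm w))
  rw [continuousOn_univ] at hσ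
  have : ∀ w, ∃ τ : ℂ → ℂ, ContinuousOn τ {z | (z, w) ∈ X} ∧
      (∀ z, (z, w) ∈ X → exp (τ z) = F (z, w)) ∧ τ (sec w) = σ w := by
    intro w
    obtain ⟨t, ht, hte⟩ := hfib w
    refine ⟨fun z => t z + (σ w - t (sec w)), by fun_prop, fun z hz => ?_, by ring⟩
    rw [exp_add, exp_sub, hσe w trivial, hte _ (hsm w), div_self (h0 _ (hsm w)), mul_one]
    exact hte z hz
  choose τ hτ hτe hτs using this
  refine ⟨fun p => τ p.2 p.1, ?_, fun p hp => hτe p.2 p.1 hp⟩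
  rintro ⟨z0, w0⟩ hp0
  apply ContinuousAt.continuousWithinAt
  obtain ⟨c, hc⟩ := (hpc w0).joinedIn _ (hsm w0) _ hp0
  let Φ : unitInterval × (ℂ × ℂ) → ℂ × ℂ := fun q =>
    (c q.1 + (q.1 : ℝ) * (q.2.1 - z0) + (1 - (q.1 : ℝ)) * (sec q.2.2 - sec w0), q.2.2)
  have hΦ : Continuous Φ := by fun_prop
  obtain ⟨U, V, hU, hV, hU1, hV1, hUV⟩ := generalized_tube_lemma (s := (univ : Set unitInterval))
    isCompact_univ (t := {(z0, w0)}) isCompact_singleton (n := Φ ⁻¹' X) (hX.preimage hΦ) (by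
      rintro ⟨t, p⟩ ⟨-, hp⟩
      rw [mem_singleton_iff] at hp
      subst hp
      have := hc t
      simpa [Φ] using this)
  have hmem : ∀ (t : unitInterval), ∀ v ∈ V, Φ (t, v) ∈ X := fun t v hv =>
    hUV ⟨hU1 trivial, hv⟩
  obtain ⟨Λ, hΛ, hΛe, hΛ0⟩ := HL (Y := V) (fun q => F (Φ (q.1, q.2)))
    (hF.comp_continuous (by fun_prop) (fun q => hmem _ _ q.2.2))
    (fun q => h0 _ (hmem _ _ q.2.2)) (fun v => σ v.1.2) (by fun_prop) (fun v => by
      rw [hσe _ trivial]; simp [Φ])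
  have key : ∀ v : V, τ v.1.2 v.1.1 = Λ (1, v) := by
    intro v
    obtain ⟨n, hn⟩ := UQ (U := (univ : Set unitInterval)) isPreconnected_univ
      (s := fun t => τ v.1.2 (Φ (t, v)).1) (t := fun t => Λ (t, v))
      (((hτ v.1.2).comp_continuous (f := fun t => (Φ (t, v)).1) (by fun_prop)
        (fun t => hmem t v v.2)).continuousOn) (by fun_prop) (fun t _ => by
          rw [hΛe]; exact hτe _ _ (hmem t v v.2))
    have e0 := hn 0 trivial
    have e1 := hn 1 trivial
    rw [hΛ0] at e0
    simp only [Φ, Path.source, Path.target] at e0 e1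
    simp [hτs] at e0
    rw [e0] at e1
    simpa using e1
  have hV0 : (z0, w0) ∈ V := hV1 rfl
  have : ContinuousOn (fun p : ℂ × ℂ => τ p.2 p.1) V := by
    rw [continuousOn_iff_continuous_domRestrict]
    have h2 : Continuous fun v : V => Λ (1, v) := by fun_prop
    convert h2 using 2 with v
    exact key v
  exact this.continuousAt (hV.mem_nhds hV0)

end Maz

namespace Maz
open Complex Set Topology

/-- real-linear map `w ↦ a w + b w̄` -/
noncomputable def pl (a b w : ℂ) : ℂ := a * w + b * (starRingEnd ℂ) w

/-- complement of the arrangement -/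
def XX (a b : Fin 6 → ℂ) : Set (ℂ × ℂ) := {p | ∀ x, p.1 - pl (a x) (b x) p.2 ≠ 0}

noncomputable def ff (a b : Fin 6 → ℂ) (x : Fin 6) (p : ℂ × ℂ) : ℂ := p.1 - pl (a x) (b x) p.2

/-- transversality -/
def Tr (a b : Fin 6 → ℂ) : Prop := ∀ x y, x ≠ y → ‖a x - a y‖ ≠ ‖b x - b y‖

/-- linking numbers -/
noncomputable def lk (a b : Fin 6 → ℂ) (x y : Fin 6) : ℤ :=
  if x = y then 0 else if ‖b x - b y‖ < ‖a x - a y‖ then 1 else -1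

lemma pl_cont (a b : ℂ) : Continuous (pl a b) := by unfold pl; fun_prop

lemma ff_cont (a b : Fin 6 → ℂ) (x : Fin 6) : Continuous (ff a b x) := by
  unfold ff
  exact continuous_fst.sub ((pl_cont _ _).comp continuous_snd)

lemma XX_open (a b : Fin 6 → ℂ) : IsOpen (XX a b) := by
  have : XX a b = ⋂ x, {p | ff a b x p ≠ 0} := by ext p; simp [XX, ff]
  rw [this]
  exact isOpen_iInter_of_finite fun x => isOpen_ne_fun (ff_cont a b x) continuous_const

lemma pl_sub (a b a' b' w : ℂ) : pl a b w - pl a' b' w = pl (a - a') (b - b') w := by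
  unfold pl; ring

lemma pl_lower (a b w : ℂ) : |‖a‖ - ‖b‖| * ‖w‖ ≤ ‖pl a b w‖ := by
  have h := abs_norm_sub_norm_le (a * w) (-(b * (starRingEnd ℂ) w))
  rw [norm_neg, norm_mul, norm_mul, Complex.norm_conj, ← sub_mul, abs_mul, abs_norm,
    sub_neg_eq_add] at h
  exact h

lemma pl_upper (a b w : ℂ) : ‖pl a b w‖ ≤ (‖a‖ + ‖b‖) * ‖w‖ := by
  refine (norm_add_le _ _).trans ?_
  rw [norm_mul, norm_mul, Complex.norm_conj, add_mul]

lemma exists_eps {a b : Fin 6 → ℂ} (h : Tr a b) :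
    ∃ ε : ℝ, 0 < ε ∧ ∀ x y, x ≠ y → ε < |‖a x - a y‖ - ‖b x - b y‖| := by
  have : ∀ q : Fin 6 × Fin 6, ∃ δ : ℝ, 0 < δ ∧
      (q.1 ≠ q.2 → δ < |‖a q.1 - a q.2‖ - ‖b q.1 - b q.2‖|) := by
    intro q
    by_cases hq : q.1 = q.2
    · exact ⟨1, one_pos, fun h => absurd hq h⟩
    · have := abs_pos.2 (sub_ne_zero.2 (h _ _ hq))
      exact ⟨_, half_pos this, fun _ => half_lt_self this⟩
  choose δ hδ hδ' using this
  obtain ⟨q, hq⟩ := Finite.exists_min δ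
  exact ⟨δ q, hδ q, fun x y hxy => (hq (x, y)).trans_lt (hδ' (x, y) hxy)⟩

lemma mer_mem {a b : Fin 6 → ℂ} {ε : ℝ}
    (h : ∀ x y, x ≠ y → ε < |‖a x - a y‖ - ‖b x - b y‖|) (x : Fin 6) {w v : ℂ} (hw : w ≠ 0)
    (hv : v ≠ 0) (hv' : ‖v‖ ≤ ε * ‖w‖) : (pl (a x) (b x) w + v, w) ∈ XX a b := by
  intro y hy
  simp only at hy
  by_cases hxy : x = y
  · subst hxy; simp at hy; exact hv hy
  · have h1 : pl (a x - a y) (b x - b y) w = -v := by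
      rw [← pl_sub]; linear_combination hy
    have h2 := pl_lower (a x - a y) (b x - b y) w
    rw [h1, norm_neg] at h2
    have h3 := mul_lt_mul_of_pos_right (h x y hxy) (norm_pos_iff.2 hw)
    linarith

/-- the torus around plane `x` -/
noncomputable def TT (a b : Fin 6 → ℂ) (ε : ℝ) (x : Fin 6) (q : ℝ × ℝ) : ℂ × ℂ :=
  (pl (a x) (b x) (exp (2 * Real.pi * q.1 * I)) + ε * exp (2 * Real.pi * q.2 * I),
    exp (2 * Real.pi * q.1 * I))

lemma exp_per (x : ℝ) : exp (2 * Real.pi * ((x + 1 : ℝ) : ℂ) * I) = exp (2 * Real.pi * x * I) := by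
  have : (2 * Real.pi * ((x + 1 : ℝ) : ℂ) * I) = 2 * Real.pi * x * I + 2 * Real.pi * I := by
    push_cast; ring
  rw [this, exp_periodic]

lemma norm_e (x : ℝ) : ‖exp (2 * Real.pi * x * I)‖ = 1 := by
  have : (2 * Real.pi * x * I : ℂ) = ((2 * Real.pi * x : ℝ) : ℂ) * I := by push_cast; ring
  rw [this, norm_exp_ofReal_mul_I]

lemma TT_dper (a b : Fin 6 → ℂ) (ε : ℝ) (x : Fin 6) : Dper (TT a b ε x) := by
  refine ⟨?_, fun u v => ?_, fun u v => ?_⟩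
  · have := pl_cont (a x) (b x)
    unfold TT; fun_prop
  · simp only [TT, exp_per]
  · simp only [TT, exp_per]

lemma TT_mem {a b : Fin 6 → ℂ} {ε : ℝ} (hε : 0 < ε)
    (h : ∀ x y, x ≠ y → ε < |‖a x - a y‖ - ‖b x - b y‖|) (x : Fin 6) (q : ℝ × ℝ) :
    TT a b ε x q ∈ XX a b := by
  apply mer_mem h x (exp_ne_zero _) (mul_ne_zero (by exact_mod_cast hε.ne') (exp_ne_zero _))
  rw [norm_mul, norm_e, norm_e, norm_real, Real.norm_of_nonneg hε.le]

lemma Per_e1 : Per (fun q => exp (2 * Real.pi * q.1 * I)) 1 0 :=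
  ⟨fun q => 2 * Real.pi * q.1 * I, by fun_prop, fun _ => rfl, fun x y => by push_cast; ring,
    fun x y => by push_cast; ring⟩

lemma Per_e2 : Per (fun q => exp (2 * Real.pi * q.2 * I)) 0 1 :=
  ⟨fun q => 2 * Real.pi * q.2 * I, by fun_prop, fun _ => rfl, fun x y => by push_cast; ring,
    fun x y => by push_cast; ring⟩

lemma Dper_e1 : Dper (fun q : ℝ × ℝ => exp (2 * Real.pi * q.1 * I)) :=
  ⟨by fun_prop, fun x y => exp_per x, fun x y => rfl⟩

lemma ff_TT {a b : Fin 6 → ℂ} (hT : Tr a b) {ε : ℝ} (hε : 0 < ε)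
    (h : ∀ x y, x ≠ y → ε < |‖a x - a y‖ - ‖b x - b y‖|) (x y : Fin 6) :
    Per (fun q => ff a b y (TT a b ε x q)) (lk a b x y) (if x = y then 1 else 0) := by
  by_cases hxy : x = y
  · subst hxy
    have := (Per.const (c := (ε : ℂ)) (by exact_mod_cast hε.ne')).mul Per_e2
    simp only [lk, if_true]
    simpa [ff, TT] using this
  · have h1 : Per (fun q : ℝ × ℝ => pl (a x - a y) (b x - b y) (exp (2 * Real.pi * q.1 * I)))
        (lk a b x y * 1) (lk a b x y * 0) := by
      refine Per_e1.affine Dper_e1 ?_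
      simp only [lk, if_neg hxy]
      rcases lt_or_gt_of_ne (hT x y hxy) with h | h
      · right; exact ⟨h, if_neg h.not_gt⟩
      · left; exact ⟨h, if_pos h⟩
    simp only [mul_one, mul_zero] at h1
    simp only [if_neg hxy]
    refine h1.near (Dper_e1.comp (pl_cont _ _)) ((TT_dper a b ε x).comp (ff_cont a b y)) fun q => ?_
    have e : ff a b y (TT a b ε x q) - pl (a x - a y) (b x - b y) (exp (2 * Real.pi * q.1 * I))
        = ε * exp (2 * Real.pi * q.2 * I) := by
      simp only [ff, TT, ← pl_sub]; ring
    rw [e, norm_mul, norm_e, norm_real, Real.norm_of_nonneg hε.le, mul_one]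
    refine (h x y hxy).trans_le ?_
    have := pl_lower (a x - a y) (b x - b y) (exp (2 * Real.pi * q.1 * I))
    rwa [norm_e, mul_one] at this

lemma exists_R (a b : Fin 6 → ℂ) : ∃ R : ℝ, 0 < R ∧ ∀ x w, ‖pl (a x) (b x) w‖ ≤ R * ‖w‖ := by
  obtain ⟨i, hi⟩ := Finite.exists_max (fun x => ‖a x‖ + ‖b x‖)
  refine ⟨‖a i‖ + ‖b i‖ + 1, by positivity, fun x w => (pl_upper _ _ _).trans ?_⟩
  exact mul_le_mul_of_nonneg_right ((hi x).trans (by linarith)) (norm_nonneg _)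

lemma big_mem {a b : Fin 6 → ℂ} {R : ℝ} (hR : ∀ x w, ‖pl (a x) (b x) w‖ ≤ R * ‖w‖) {z w : ℂ}
    (h : R * ‖w‖ < ‖z‖) : (z, w) ∈ XX a b := by
  intro x hx
  rw [sub_eq_zero] at hx
  simp only at hx
  have := hR x w
  rw [← hx] at this
  linarith

lemma fib_eq (a b : Fin 6 → ℂ) (w : ℂ) : {z | (z, w) ∈ XX a b} =
    ((Finset.univ.image fun x => pl (a x) (b x) w : Finset ℂ) : Set ℂ)ᶜ := by
  ext z
  simp only [XX, mem_ofPred_eq, Finset.coe_image, Finset.coe_univ, image_univ, mem_compl_iff,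
    mem_range, not_exists, sub_ne_zero]
  exact forall_congr' fun x => ne_comm

/-- a nonvanishing function with trivial meridian windings has a logarithm -/
lemma log_of_mer {a b : Fin 6 → ℂ} {ε : ℝ} (hε : 0 < ε)
    (h : ∀ x y, x ≠ y → ε < |‖a x - a y‖ - ‖b x - b y‖|) {F : ℂ × ℂ → ℂ}
    (hF : ContinuousOn F (XX a b)) (h0 : ∀ p ∈ XX a b, F p ≠ 0)
    (hm : ∀ x, ∃ m, Per (fun q => F (TT a b ε x q)) m 0) : HasLogOn F (XX a b) := by
  obtain ⟨R, hR0, hR⟩ := exists_R a b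
  have hmer : ∀ x, HasLogOn (fun e => F (pl (a x) (b x) 1 + ε * e, 1)) (Metric.sphere 0 1) := by
    intro x
    obtain ⟨m, s, hs, hse, -, hs2⟩ := hm x
    refine descend (s := fun y => s (0, y)) (by fun_prop) (fun y => by simp [hs2]) fun y => ?_
    rw [hse]
    simp [TT]
  have hsph : ∀ x (w : ℂ), w ≠ 0 → ∀ ρ : ℝ, 0 < ρ → ρ ≤ ε * ‖w‖ →
      HasLogOn (fun z => F (z, w)) (Metric.sphere (pl (a x) (b x) w) ρ) := by
    intro x w hw ρ hρ hρ'
    have hwn : 0 < ‖w‖ := norm_pos_iff.2 hw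
    let K : ℝ × ℂ → ℂ × ℂ := fun q => (pl (a x) (b x) (exp (q.1 * log w)) +
      ((‖exp (q.1 * log w)‖ * ((1 - q.1) * ε + q.1 * (ρ / ‖w‖)) : ℝ) : ℂ) * q.2, exp (q.1 * log w))
    have hK : Continuous K := by
      have := pl_cont (a x) (b x)
      fun_prop
    have hKm : ∀ q ∈ Icc (0:ℝ) 1 ×ˢ Metric.sphere (0:ℂ) 1, K q ∈ XX a b := by
      rintro ⟨t, e⟩ ⟨⟨ht0, ht1⟩, he⟩
      simp only at ht0 ht1
      have hen : ‖e‖ = 1 := mem_sphere_zero_iff_norm.1 he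
      have hρw : 0 < ρ / ‖w‖ := by positivity
      have hρw' : ρ / ‖w‖ ≤ ε := by rwa [div_le_iff₀ hwn]
      have hc : 0 < (1 - t) * ε + t * (ρ / ‖w‖) := by
        have : ρ / ‖w‖ ≤ (1 - t) * ε + t * (ρ / ‖w‖) := by nlinarith
        linarith
      have hc' : (1 - t) * ε + t * (ρ / ‖w‖) ≤ ε := by nlinarith
      have hpos : 0 < ‖exp (t * log w)‖ := norm_pos_iff.2 (exp_ne_zero _)
      have hn : ‖((‖exp (t * log w)‖ * ((1 - t) * ε + t * (ρ / ‖w‖)) : ℝ) : ℂ) * e‖ =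
          ‖exp (t * log w)‖ * ((1 - t) * ε + t * (ρ / ‖w‖)) := by
        rw [norm_mul, hen, mul_one, norm_real, Real.norm_of_nonneg (by positivity)]
      refine mer_mem h x (exp_ne_zero _) ?_ ?_
      · rw [← norm_pos_iff, hn]; positivity
      · simp only
        rw [hn, mul_comm]
        exact mul_le_mul_of_nonneg_right hc' hpos.le
    have h1 := hl_on (U := Metric.sphere (0:ℂ) 1) (G := fun q => F (K q))
      (hF.comp hK.continuousOn hKm) (fun q hq => h0 _ (hKm q hq)) ((hmer x).congr (fun e _ => by
        simp [K]))
    have hρC : (ρ : ℂ) ≠ 0 := by exact_mod_cast hρ.ne'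
    have h2 := h1.comp (g := fun z => (z - pl (a x) (b x) w) / ρ)
      (V := Metric.sphere (pl (a x) (b x) w) ρ) (by fun_prop) (fun z hz => by
        rw [mem_sphere_iff_norm] at hz
        rw [mem_sphere_zero_iff_norm, norm_div, hz, norm_real, Real.norm_of_nonneg hρ.le,
          div_self hρ.ne'])
    refine h2.congr fun z _ => ?_
    have hwC : (‖w‖ : ℂ) ≠ 0 := by exact_mod_cast hwn.ne'
    simp only [K, ofReal_one, one_mul, exp_log hw, sub_self, zero_mul, zero_add]
    congr 2
    push_cast
    field_simp
    ring
  have hfib1 : ∀ w, w ≠ 0 → HasLogOn (fun z => F (z, w)) {z | (z, w) ∈ XX a b} := by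
    intro w hw
    have hc : ContinuousOn (fun z => F (z, w)) {z | (z, w) ∈ XX a b} :=
      hF.comp (by fun_prop) (fun z hz => hz)
    have hn : ∀ z ∈ {z | (z, w) ∈ XX a b}, F (z, w) ≠ 0 := fun z hz => h0 _ hz
    rw [fib_eq] at *
    refine multi_puncture _ _ hc hn fun s hs => ?_
    obtain ⟨x, -, rfl⟩ := Finset.mem_image.1 hs
    exact ⟨ε * ‖w‖, mul_pos hε (norm_pos_iff.2 hw), hsph x w hw⟩
  have hfib : ∀ w, HasLogOn (fun z => F (z, w)) {z | (z, w) ∈ XX a b} := by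
    intro w
    by_cases hw : w = 0
    swap
    · exact hfib1 w hw
    subst hw
    have hc : ContinuousOn (fun z => F (z, 0)) {z | (z, 0) ∈ XX a b} :=
      hF.comp (by fun_prop) (fun z hz => hz)
    have hn : ∀ z ∈ {z | (z, 0) ∈ XX a b}, F (z, 0) ≠ 0 := fun z hz => h0 _ hz
    rw [fib_eq] at *
    refine multi_puncture _ _ hc hn fun s hs => ?_
    obtain ⟨x, -, rfl⟩ := Finset.mem_image.1 hs
    refine ⟨1, one_pos, fun ρ hρ _ => ?_⟩
    have e0 : pl (a x) (b x) 0 = 0 := by simp [pl]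
    rw [e0]
    obtain ⟨r, hr⟩ : ∃ r : ℝ, r = ρ / (2 * R) := ⟨_, rfl⟩
    have hr0 : 0 < r := by rw [hr]; positivity
    have hrR : R * r < ρ := by rw [hr]; field_simp; linarith
    have hmem : ∀ q ∈ Icc (0:ℝ) 1 ×ˢ Metric.sphere (0:ℂ) ρ,
        (q.2, (((1 - q.1) * r : ℝ) : ℂ)) ∈ XX a b := by
      rintro ⟨t, z⟩ ⟨⟨ht0, ht1⟩, hz⟩
      apply big_mem hR
      simp only at ht0 ht1
      rw [mem_sphere_zero_iff_norm] at hz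
      rw [hz, norm_real, Real.norm_of_nonneg (mul_nonneg (by linarith) hr0.le)]
      nlinarith [mul_nonneg ht0 (mul_pos hR0 hr0).le]
    have h1 := hl_on (U := Metric.sphere (0:ℂ) ρ) (G := fun q => F (q.2, (((1 - q.1) * r : ℝ) : ℂ)))
      (hF.comp (by fun_prop) hmem) (fun q hq => h0 _ (hmem q hq))
      (((hfib1 (r : ℂ) (by exact_mod_cast hr0.ne')).comp (g := fun z => z) (by fun_prop)
        (fun z hz => by
          have := hmem (0, z) ⟨by simp, hz⟩
          simpa using this)).congr (fun z _ => by simp))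
    exact h1.congr fun z _ => by simp
  refine total (XX_open a b) (fun w => ((R * ‖w‖ + 1 : ℝ) : ℂ)) (by fun_prop) (fun w => ?_)
    (fun w => ?_) hF h0 hfib
  · apply big_mem hR
    rw [norm_real, Real.norm_of_nonneg (by positivity)]
    linarith
  · rw [fib_eq]
    exact (Finset.countable_toSet _).isPathConnected_compl_of_one_lt_rank (by simp)

end Maz

namespace Maz
open Complex Set Topology

section abstractpart
variable {X Y : Type*} [TopologicalSpace X] [TopologicalSpace Y]

def NV (F : X → ℂ) : Prop := Continuous F ∧ ∀ x, F x ≠ 0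

def Sim (F G : X → ℂ) : Prop := ∃ h : X → ℂ, Continuous h ∧ ∀ x, F x = G x * exp (h x)

def Perp (F G : X → ℂ) : Prop := ∀ T : ℝ × ℝ → X, Dper T → ∀ m n m' n' : ℤ,
  Per (fun q => F (T q)) m n → Per (fun q => G (T q)) m' n' → m * n' = n * m'

def Special (F : X → ℂ) : Prop := ∀ G G' : X → ℂ, NV G → NV G' →
  ∃ c c' : ℤ, (c ≠ 0 ∨ c' ≠ 0) ∧ Perp F (fun x => G x ^ c * G' x ^ c')

lemma Sim.symm {F G : X → ℂ} (h : Sim F G) : Sim G F := by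
  obtain ⟨s, hs, he⟩ := h
  refine ⟨fun x => - s x, by fun_prop, fun x => ?_⟩
  rw [he, mul_assoc, ← exp_add]; simp

lemma Sim.trans {F G H : X → ℂ} (h : Sim F G) (h' : Sim G H) : Sim F H := by
  obtain ⟨s, hs, he⟩ := h
  obtain ⟨t, ht, he'⟩ := h'
  refine ⟨fun x => t x + s x, by fun_prop, fun x => ?_⟩
  rw [he, he', mul_assoc, ← exp_add]

lemma Sim.mul {F G F' G' : X → ℂ} (h : Sim F G) (h' : Sim F' G') :
    Sim (fun x => F x * F' x) (fun x => G x * G' x) := by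
  obtain ⟨s, hs, he⟩ := h
  obtain ⟨t, ht, he'⟩ := h'
  refine ⟨fun x => s x + t x, by fun_prop, fun x => ?_⟩
  simp only [he, he', exp_add]; ring

lemma Sim.zpow {F G : X → ℂ} (h : Sim F G) (k : ℤ) : Sim (fun x => F x ^ k) (fun x => G x ^ k) := by
  obtain ⟨s, hs, he⟩ := h
  refine ⟨fun x => k * s x, by fun_prop, fun x => ?_⟩
  simp only [he, exp_int_mul, mul_zpow]

lemma Sim.per {F G : X → ℂ} (h : Sim F G) {T : ℝ × ℝ → X} (hT : Dper T) {m n : ℤ}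
    (hG : Per (fun q => G (T q)) m n) : Per (fun q => F (T q)) m n := by
  obtain ⟨s, hs, he⟩ := h
  have := hG.mul (Per.of_exp (hT.comp hs))
  simp only [add_zero, ← he] at this
  exact this

lemma Sim.comp {F G : X → ℂ} (h : Sim F G) {f : Y → X} (hf : Continuous f) :
    Sim (fun y => F (f y)) (fun y => G (f y)) := by
  obtain ⟨s, hs, he⟩ := h
  exact ⟨fun y => s (f y), by fun_prop, fun y => he _⟩

lemma Sim.homotopic {f0 f1 : C(Y, X)} (h : f0.Homotopic f1) {F : X → ℂ} (hF : NV F) :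
    Sim (fun y => F (f1 y)) (fun y => F (f0 y)) := by
  obtain ⟨K⟩ := h
  obtain ⟨hc, hn⟩ := hF
  obtain ⟨Λ, h1, h2, -⟩ := HL (Y := Y) (fun q => F (K q) / F (K (0, q.2)))
    ((by fun_prop : Continuous fun q : unitInterval × Y => F (K q)).div (by fun_prop)
      (fun q => hn _)) (fun q => div_ne_zero (hn _) (hn _)) (fun _ => 0) (by fun_prop)
      (fun y => by rw [exp_zero, div_self (hn _)])
  refine ⟨fun y => Λ (1, y), by fun_prop, fun y => ?_⟩
  rw [h2]
  simp only [ContinuousMap.Homotopy.apply_zero, ContinuousMap.Homotopy.apply_one]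
  rw [mul_div_cancel₀ _ (hn _)]

lemma Special.pull (e : ContinuousMap.HomotopyEquiv X Y) {F : Y → ℂ} (hF : Special F) :
    Special (fun x => F (e.toFun x)) := by
  intro G G' hG hG'
  obtain ⟨c, c', h1, h2⟩ := hF (fun y => G (e.invFun y)) (fun y => G' (e.invFun y))
    ⟨hG.1.comp e.invFun.continuous, fun y => hG.2 _⟩
    ⟨hG'.1.comp e.invFun.continuous, fun y => hG'.2 _⟩
  refine ⟨c, c', h1, fun T hT m n m' n' p1 p2 => ?_⟩
  refine h2 (fun q => e.toFun (T q)) (hT.comp e.toFun.continuous) m n m' n' p1 ?_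
  have s1 := (Sim.homotopic e.left_inv hG).symm.zpow c
  have s2 := (Sim.homotopic e.left_inv hG').symm.zpow c'
  exact (s1.mul s2).per hT p2

end abstractpart

/-- monomials in the defining functions -/
noncomputable def mono (a b : Fin 6 → ℂ) (A : Fin 6 → ℤ) (p : XX a b) : ℂ :=
  ∏ x, ff a b x p ^ A x

lemma ff_ne {a b : Fin 6 → ℂ} (p : XX a b) (x : Fin 6) : ff a b x p ≠ 0 := p.2 x

lemma mono_nv (a b : Fin 6 → ℂ) (A : Fin 6 → ℤ) : NV (mono a b A) := by
  constructor
  · unfold mono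
    refine continuous_finsetProd _ fun x _ => ?_
    exact ((ff_cont a b x).comp continuous_subtype_val).zpow₀ _ fun p => Or.inl (ff_ne p x)
  · exact fun p => Finset.prod_ne_zero_iff.2 fun x _ => zpow_ne_zero _ (ff_ne p x)

lemma mono_zero (a b : Fin 6 → ℂ) (p : XX a b) : mono a b 0 p = 1 := by simp [mono]

lemma mono_comb (a b : Fin 6 → ℂ) (A B : Fin 6 → ℤ) (c d : ℤ) (p : XX a b) :
    mono a b A p ^ c * mono a b B p ^ d = mono a b (c • A + d • B) p := by
  simp only [mono]
  rw [← Finset.prod_zpow, ← Finset.prod_zpow, ← Finset.prod_mul_distrib]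
  refine Finset.prod_congr rfl fun x _ => ?_
  rw [← zpow_mul, ← zpow_mul, ← zpow_add₀ (ff_ne p x)]
  simp [mul_comm]

lemma mono_per {a b : Fin 6 → ℂ} {T : ℝ × ℝ → XX a b} {m n : Fin 6 → ℤ}
    (h : ∀ x, Per (fun q => ff a b x (T q)) (m x) (n x)) (A : Fin 6 → ℤ) :
    Per (fun q => mono a b A (T q)) (∑ x, A x * m x) (∑ x, A x * n x) :=
  Per.prod Finset.univ h A

lemma exists_tori {a b : Fin 6 → ℂ} (hT : Tr a b) (x : Fin 6) : ∃ T : ℝ × ℝ → XX a b, Dper T ∧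
    ∀ y, Per (fun q => ff a b y (T q)) (lk a b x y) (if x = y then 1 else 0) := by
  obtain ⟨ε, hε, h⟩ := exists_eps hT
  have h1 := TT_dper a b ε x
  refine ⟨fun q => ⟨TT a b ε x q, TT_mem hε h x q⟩, ⟨h1.1.subtype_mk _, fun u v => ?_,
    fun u v => ?_⟩, fun y => ff_TT hT hε h x y⟩
  · exact Subtype.ext (h1.2.1 u v)
  · exact Subtype.ext (h1.2.2 u v)

lemma mono_tori {a b : Fin 6 → ℂ} (hT : Tr a b) (x : Fin 6) : ∃ T : ℝ × ℝ → XX a b, Dper T ∧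
    ∀ A, Per (fun q => mono a b A (T q)) (∑ y, A y * lk a b x y) (A x) := by
  obtain ⟨T, h1, h2⟩ := exists_tori hT x
  refine ⟨T, h1, fun A => ?_⟩
  have := mono_per h2 A
  simpa using this

lemma mono_sim_one {a b : Fin 6 → ℂ} (hT : Tr a b) {A : Fin 6 → ℤ}
    (h : Sim (mono a b A) (fun _ => 1)) : A = 0 := by
  funext x
  obtain ⟨T, h1, h2⟩ := mono_tori hT x
  have := h.per h1 (Per.const one_ne_zero)
  exact ((h2 A).unique this).2

lemma classify {a b : Fin 6 → ℂ} (hT : Tr a b) {F : XX a b → ℂ} (hF : NV F) :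
    ∃ A, Sim F (mono a b A) := by
  classical
  obtain ⟨ε, hε, h⟩ := exists_eps hT
  let T : Fin 6 → ℝ × ℝ → XX a b := fun x q => ⟨TT a b ε x q, TT_mem hε h x q⟩
  have hTd : ∀ x, Dper (T x) := fun x =>
    ⟨(TT_dper a b ε x).1.subtype_mk _, fun u v => Subtype.ext ((TT_dper a b ε x).2.1 u v),
      fun u v => Subtype.ext ((TT_dper a b ε x).2.2 u v)⟩
  have hTp : ∀ x A, Per (fun q => mono a b A (T x q)) (∑ y, A y * lk a b x y) (A x) := by
    intro x A
    have := mono_per (T := T x) (fun y => ff_TT hT hε h x y) A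
    simpa using this
  have hex := fun x => Per.exists ((hTd x).comp hF.1) (fun q => hF.2 (T x q))
  choose m A hA using hex
  let F' : XX a b → ℂ := fun p => F p * mono a b (-A) p
  have hF' : NV F' := ⟨hF.1.mul (mono_nv _ _ _).1, fun p => mul_ne_zero (hF.2 p) ((mono_nv _ _ _).2 p)⟩
  let G : ℂ × ℂ → ℂ := fun p => if hp : p ∈ XX a b then F' ⟨p, hp⟩ else 0
  have hG : ∀ p : XX a b, G p = F' p := fun p => by simp [G]
  have hGc : ContinuousOn G (XX a b) := by
    rw [continuousOn_iff_continuous_domRestrict]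
    exact hF'.1.congr fun p => (hG p).symm
  obtain ⟨s, hs, hse⟩ := log_of_mer hε h hGc (fun p hp => by
    rw [hG ⟨p, hp⟩]; exact hF'.2 _) (fun x => by
      have := (hA x).mul (hTp x (-A))
      simp only [Pi.neg_apply, add_neg_cancel] at this
      have e : (fun q => G (TT a b ε x q)) = fun q => F' (T x q) := funext fun q => hG (T x q)
      rw [e]
      exact ⟨_, this⟩)
  refine ⟨A, fun p => s p, hs.comp_continuous continuous_subtype_val fun p => p.2, fun p => ?_⟩
  rw [hse _ p.2, hG]
  have := mono_comb a b A (-A) 1 1 p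
  simp only [zpow_one, one_smul, add_neg_cancel, mono_zero] at this
  simp only [F']
  linear_combination -(F p) * this

lemma lk_sign {a b : Fin 6 → ℂ} (hT : Tr a b) {x y : Fin 6} (hxy : x ≠ y) :
    (‖b x - b y‖ < ‖a x - a y‖ ∧ lk a b x y = 1) ∨
      (‖a x - a y‖ < ‖b x - b y‖ ∧ lk a b x y = -1) := by
  simp only [lk, if_neg hxy]
  rcases lt_or_gt_of_ne (hT x y hxy) with h | h
  · right; exact ⟨h, if_neg h.not_gt⟩
  · left; exact ⟨h, if_pos h⟩

lemma lk_sq {a b : Fin 6 → ℂ} (hT : Tr a b) {x y : Fin 6} (hxy : x ≠ y) :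
    lk a b x y * lk a b x y = 1 := by
  rcases lk_sign hT hxy with h | h <;> rw [h.2] <;> norm_num

lemma lk_symm (a b : Fin 6 → ℂ) (x y : Fin 6) : lk a b x y = lk a b y x := by
  simp only [lk, norm_sub_rev (a x), norm_sub_rev (b x), eq_comm]

/-- the key relation for a twin pair -/
lemma twin_rel {a b : Fin 6 → ℂ} (hT : Tr a b) {i j k : Fin 6} (hij : i ≠ j) (hik : k ≠ i)
    (hjk : k ≠ j) (htw : lk a b i k = lk a b j k) {T : ℝ × ℝ → XX a b} (hTd : Dper T)
    {m n : Fin 6 → ℤ} (h : ∀ x, Per (fun q => ff a b x (T q)) (m x) (n x)) :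
    (m i - m j) * n k - (n i - n j) * m k
      = lk a b i k * lk a b i j * ((m i - m j) * n i - (n i - n j) * m i) := by
  have hfd : ∀ x, Dper (fun q => ff a b x (T q)) := fun x =>
    hTd.comp (f := fun p : XX a b => ff a b x p) ((ff_cont a b x).comp continuous_subtype_val)
  obtain ⟨α, hα⟩ : ∃ α, α = a i - a j := ⟨_, rfl⟩
  obtain ⟨β, hβ⟩ : ∃ β, β = b i - b j := ⟨_, rfl⟩
  have hD : α * (starRingEnd ℂ) α - β * (starRingEnd ℂ) β ≠ 0 := by
    rw [mul_conj, mul_conj, ← ofReal_sub, ofReal_ne_zero, sub_ne_zero, normSq_eq_norm_sq,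
      normSq_eq_norm_sq, hα, hβ]
    intro h2
    exact hT i j hij ((sq_eq_sq₀ (norm_nonneg _) (norm_nonneg _)).1 h2)
  obtain ⟨D, hDD⟩ : ∃ D, D = α * (starRingEnd ℂ) α - β * (starRingEnd ℂ) β := ⟨_, rfl⟩
  rw [← hDD] at hD
  have hadj : ∀ x, Per (fun q => pl ((starRingEnd ℂ) α) (-β) (ff a b x (T q)))
      (lk a b i j * m x) (lk a b i j * n x) := by
    intro x
    refine (h x).affine (hfd x) ?_
    rw [norm_neg, Complex.norm_conj, hα, hβ]
    exact lk_sign hT hij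
  have hadjd : ∀ x, Dper (fun q => pl ((starRingEnd ℂ) α) (-β) (ff a b x (T q))) :=
    fun x => (hfd x).comp (pl_cont _ _)
  have hL2 := (hadj j).affine (hadjd j) (lk_sign hT (Ne.symm hik))
  have hL1 := (hadj i).affine (hadjd i) (lk_sign hT hjk)
  have hk := ((Per.const hD).mul (h k)).zpow (-1)
  have P1 := hL1.mul hk
  have P2 := hL2.mul hk
  have hs := sum_one P1 P2 (fun q => by
    have hne : D * ff a b k (T q) ≠ 0 := mul_ne_zero hD (ff_ne _ _)
    rw [← add_mul, zpow_neg_one, ← div_eq_mul_inv, div_eq_one_iff_eq hne, hDD, hα, hβ]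
    simp only [ff, pl, map_add, map_sub, map_mul, map_neg, conj_conj]
    ring)
  rw [lk_symm a b k j, ← htw] at hs
  have s1 := lk_sq hT (Ne.symm hik)
  have s2 := lk_sq hT hij
  generalize lk a b i k = u at *
  generalize lk a b i j = v at *
  have s3 : (u * v) * (u * v) = 1 := by linear_combination s1 * v * v + s2
  linear_combination (-(u * v)) * hs + (u * v * (m i * n j - n i * m j) - (m i - m j) * n k + (n i - n j) * m k) * s3

lemma twin_special {a b : Fin 6 → ℂ} (hT : Tr a b) {i j : Fin 6} (hij : i ≠ j)
    (htw : ∀ k, k ≠ i → k ≠ j → lk a b i k = lk a b j k) :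
    Special (mono a b (Pi.single i 1 - Pi.single j 1)) := by
  classical
  intro G G' hG hG'
  obtain ⟨B, hB⟩ := classify hT hG
  obtain ⟨B', hB'⟩ := classify hT hG'
  let σ : Fin 6 → ℤ := fun k => if k = i ∨ k = j then 1 else lk a b i k * lk a b i j
  have main : ∀ c c' : ℤ, c * (∑ x, B x * σ x) + c' * (∑ x, B' x * σ x) = 0 →
      Perp (mono a b (Pi.single i 1 - Pi.single j 1)) (fun x => G x ^ c * G' x ^ c') := by
    intro c c' hcc T hTd M N M' N' p1 p2
    have hex : ∀ x, ∃ m n, Per (fun q => ff a b x (T q)) m n := fun x =>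
      Per.exists (hTd.comp (f := fun p : XX a b => ff a b x p)
        ((ff_cont a b x).comp continuous_subtype_val)) (fun q => ff_ne _ _)
    choose m n h using hex
    have q1 := mono_per h (Pi.single i 1 - Pi.single j 1)
    have q2 := mono_per h (c • B + c' • B')
    have q3 := ((hB.zpow c).mul (hB'.zpow c')).symm.per hTd p2
    simp only [mono_comb] at q3
    obtain ⟨rfl, rfl⟩ := p1.unique q1
    obtain ⟨rfl, rfl⟩ := q3.unique q2
    have hE : ∀ x, (m i - m j) * n x - (n i - n j) * m x
        = σ x * ((m i - m j) * n i - (n i - n j) * m i) := by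
      intro x
      by_cases hx : x = i ∨ x = j
      · simp only [σ, if_pos hx]
        rcases hx with rfl | rfl <;> ring
      · simp only [σ, if_neg hx]
        push Not at hx
        exact twin_rel hT hij hx.1 hx.2 (htw x hx.1 hx.2) hTd h
    have e1 : ∀ f : Fin 6 → ℤ, ∑ x, (Pi.single i 1 - Pi.single j 1 : Fin 6 → ℤ) x * f x
        = f i - f j := by
      intro f
      simp [sub_mul, Finset.sum_sub_distrib, Pi.single_apply]
    rw [e1, e1, ← sub_eq_zero, Finset.mul_sum, Finset.mul_sum, ← Finset.sum_sub_distrib]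
    have e2 : ∀ x, (m i - m j) * ((c • B + c' • B') x * n x) - (n i - n j) * ((c • B + c' • B') x * m x)
        = (c * (B x * σ x) + c' * (B' x * σ x)) * ((m i - m j) * n i - (n i - n j) * m i) := by
      intro x
      simp only [Pi.add_apply, Pi.smul_apply, smul_eq_mul]
      linear_combination (c * B x + c' * B' x) * hE x
    rw [Finset.sum_congr rfl fun x _ => e2 x, ← Finset.sum_mul, Finset.sum_add_distrib,
      ← Finset.mul_sum, ← Finset.mul_sum, hcc, zero_mul]
  by_cases h1 : (∑ x, B x * σ x) = 0
  · exact ⟨1, 0, Or.inl one_ne_zero, main 1 0 (by rw [h1]; ring)⟩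
  · exact ⟨∑ x, B' x * σ x, -(∑ x, B x * σ x), Or.inr (neg_ne_zero.2 h1), main _ _ (by ring)⟩

end Maz

namespace Maz
open Complex Set Topology

/-- integer data, scaled by 4 -/
noncomputable def arr (u v : Fin 6 → ℤ) (x : Fin 6) : ℂ := (u x + v x * I) / 4

def dl (u v s t : Fin 6 → ℤ) (x y : Fin 6) : ℤ :=
  (u x - u y) * (u x - u y) + (v x - v y) * (v x - v y)
    - ((s x - s y) * (s x - s y) + (t x - t y) * (t x - t y))

lemma arr_norm (u v : Fin 6 → ℤ) (x y : Fin 6) : ‖arr u v x - arr u v y‖ ^ 2 =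
    (((u x - u y) * (u x - u y) + (v x - v y) * (v x - v y) : ℤ) : ℝ) / 16 := by
  have : arr u v x - arr u v y =
      ((((u x - u y : ℤ) : ℝ) / 4 : ℝ) : ℂ) + ((((v x - v y : ℤ) : ℝ) / 4 : ℝ) : ℂ) * I := by
    simp only [arr]; push_cast; ring
  rw [this, ← normSq_eq_norm_sq, normSq_add_mul_I]
  push_cast; ring

lemma arr_dl (u v s t : Fin 6 → ℤ) (x y : Fin 6) :
    ‖arr u v x - arr u v y‖ ^ 2 - ‖arr s t x - arr s t y‖ ^ 2 = (dl u v s t x y : ℝ) / 16 := by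
  rw [arr_norm, arr_norm, dl]; push_cast; ring

lemma arr_Tr {u v s t : Fin 6 → ℤ} (h : ∀ x y, x ≠ y → dl u v s t x y ≠ 0) :
    Tr (arr u v) (arr s t) := by
  intro x y hxy he
  have := arr_dl u v s t x y
  rw [he, sub_self] at this
  have h2 : (dl u v s t x y : ℝ) = 0 := by linarith
  exact h x y hxy (by exact_mod_cast h2)

lemma arr_lk {u v s t : Fin 6 → ℤ} (h : ∀ x y, x ≠ y → dl u v s t x y ≠ 0) (x y : Fin 6) :
    lk (arr u v) (arr s t) x y = Int.sign (dl u v s t x y) := by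
  by_cases hxy : x = y
  · subst hxy; simp [lk, dl]
  have e := arr_dl u v s t x y
  rcases lk_sign (arr_Tr h) hxy with ⟨h1, h2⟩ | ⟨h1, h2⟩
  · rw [h2, Int.sign_eq_one_of_pos]
    have := sq_lt_sq' (by linarith [norm_nonneg (arr s t x - arr s t y), norm_nonneg (arr u v x - arr u v y)]) h1
    have h3 : 0 < (dl u v s t x y : ℝ) := by linarith
    exact_mod_cast h3
  · rw [h2, Int.sign_eq_neg_one_of_neg]
    have := sq_lt_sq' (by linarith [norm_nonneg (arr s t x - arr s t y), norm_nonneg (arr u v x - arr u v y)]) h1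
    have h3 : (dl u v s t x y : ℝ) < 0 := by linarith
    exact_mod_cast h3

noncomputable def aL : Fin 6 → ℂ := arr ![10, 14, 10, 14, 24, 12] ![-10, -20, -28, -18, 0, -14]
noncomputable def bL : Fin 6 → ℂ := arr ![-6, -6, 6, 6, 0, 6] ![10, 20, 28, 18, 0, 28]
noncomputable def aM : Fin 6 → ℂ := arr ![40, 12, 10, 24, 21, 24] ![-4, -16, -20, -20, -29, 0]
noncomputable def bM : Fin 6 → ℂ := arr ![-36, 4, -2, -2, -1, 0] ![16, 16, 20, 20, 9, 0]

def lL : Fin 6 → Fin 6 → ℤ := ![![0, 1, -1, -1, 1, -1], ![1, 0, -1, -1, 1, -1],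
  ![-1, -1, 0, 1, 1, 1], ![-1, -1, 1, 0, 1, -1], ![1, 1, 1, 1, 0, -1], ![-1, -1, 1, -1, -1, 0]]

def lM : Fin 6 → Fin 6 → ℤ := ![![0, -1, -1, -1, -1, -1], ![-1, 0, -1, 1, 1, 1],
  ![-1, -1, 0, 1, 1, 1], ![-1, 1, 1, 0, -1, -1], ![-1, 1, 1, -1, 0, 1], ![-1, 1, 1, -1, 1, 0]]

lemma TrL : Tr aL bL := arr_Tr (by decide)
lemma TrM : Tr aM bM := arr_Tr (by decide)
lemma lkL : ∀ x y, lk aL bL x y = lL x y := by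
  intro x y
  rw [aL, bL, arr_lk (by decide)]
  revert x y
  decide
lemma lkM : ∀ x y, lk aM bM x y = lM x y := by
  intro x y
  rw [aM, bM, arr_lk (by decide)]
  revert x y
  decide

lemma XX_prod (a b : Fin 6 → ℂ) : XX a b = {p | ∏ x, ff a b x p ≠ 0} := by
  ext p
  simp only [XX, mem_ofPred_eq, Finset.prod_ne_zero_iff, Finset.mem_univ, true_imp_iff, ff]

lemma setL : {p : ℂ × ℂ | mazFL p.1 p.2 ≠ 0} = XX aL bL := by
  rw [XX_prod]
  ext p
  rw [mem_ofPred_eq, mem_ofPred_eq]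
  have : mazFL p.1 p.2 = ∏ x, ff aL bL x p := by
    rw [Fin.prod_univ_six]
    simp only [mazFL, mazG, ff, pl, aL, bL, arr]
    congr 1
    · congr 1
      · congr 1
        · congr 1
          · congr 1 <;> · simp; ring
          · simp; ring
        · simp; ring
      · simp; left; ring
    · simp; ring
  rw [this]

lemma setM : {p : ℂ × ℂ | mazFM p.1 p.2 ≠ 0} = XX aM bM := by
  rw [XX_prod]
  ext p
  rw [mem_ofPred_eq, mem_ofPred_eq]
  have : mazFM p.1 p.2 = ∏ x, ff aM bM x p := by
    rw [Fin.prod_univ_six]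
    simp only [mazFM, ff, pl, aM, bM, arr]
    congr 1
    · congr 1
      · congr 1
        · congr 1
          · congr 1 <;> · simp; ring
          · simp; ring
        · simp; ring
      · simp; ring
    · simp; left; ring
  rw [this]

lemma algL (A : Fin 6 → ℤ) (h : ∀ p q, ∃ c c' : ℤ, (c ≠ 0 ∨ c' ≠ 0) ∧ ∀ x,
    (∑ y, A y * lL x y) * ((if x = p then c else 0) + (if x = q then c' else 0))
      = A x * (c * lL x p + c' * lL x q)) : ∃ k : ℤ, A = k • (Pi.single 0 1 - Pi.single 1 1) := by
  have h1 : ∀ x y, x ≠ y → (2 ≤ x) → A x ≠ 0 → A y = 0 := by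
    intro x y hxy hx hAx
    by_contra hAy
    have : ∀ x y : Fin 6, x ≠ y → 2 ≤ x → ∃ p q, x ≠ p ∧ x ≠ q ∧ y ≠ p ∧ y ≠ q ∧
      lL x p * lL y q ≠ lL x q * lL y p := by decide
    obtain ⟨p, q, e1, e2, e3, e4, e5⟩ := this x y hxy hx
    obtain ⟨c, c', hc, hr⟩ := h p q
    have r1 := hr x
    have r2 := hr y
    simp only [if_neg e1, if_neg e2, if_neg e3, if_neg e4, add_zero, mul_zero] at r1 r2
    have r1' := (mul_eq_zero.1 r1.symm).resolve_left hAx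
    have r2' := (mul_eq_zero.1 r2.symm).resolve_left hAy
    have hd := sub_ne_zero.2 e5
    rcases hc with hc | hc
    · exact (mul_ne_zero hc hd) (by linear_combination lL y q * r1' - lL x q * r2')
    · exact (mul_ne_zero hc hd) (by linear_combination lL x p * r2' - lL y p * r1')
  have h2 : ∀ p q, p ≠ q → A p = 0 → A q = 0 → (∑ y, A y * lL p y) ≠ 0 →
      (∑ y, A y * lL q y) ≠ 0 → False := by
    intro p q hpq hp hq sp sq
    obtain ⟨c, c', hc, hr⟩ := h p q
    have r1 := hr p
    have r2 := hr q
    simp only [if_neg hpq, if_neg hpq.symm, if_true, add_zero, zero_add, hp, hq, zero_mul] at r1 r2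
    have r1' := (mul_eq_zero.1 r1).resolve_left sp
    have r2' := (mul_eq_zero.1 r2).resolve_left sq
    tauto
  have h3 : ∀ x, 2 ≤ x → A x = 0 := by
    intro x hx
    by_contra hAx
    have hz : ∀ y, y ≠ x → A y = 0 := fun y hy => h1 x y hy.symm hx hAx
    have : ∀ x : Fin 6, ∃ p q, p ≠ q ∧ p ≠ x ∧ q ≠ x ∧ lL p x ≠ 0 ∧ lL q x ≠ 0 := by decide
    obtain ⟨p, q, e1, e2, e3, e4, e5⟩ := this x
    have hs : ∀ p, (∑ y, A y * lL p y) = A x * lL p x := by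
      intro p
      refine Finset.sum_eq_single x (fun y _ hy => by rw [hz y hy, zero_mul]) (by simp)
    refine h2 p q e1 (hz p e2) (hz q e3) ?_ ?_ <;> rw [hs] <;> exact mul_ne_zero hAx (by assumption)
  have z2 := h3 2 (by decide)
  have z3 := h3 3 (by decide)
  have z4 := h3 4 (by decide)
  have z5 := h3 5 (by decide)
  have h4 : A 0 + A 1 = 0 := by
    by_contra hne
    refine h2 2 3 (by decide) z2 z3 ?_ ?_ <;>
    · simp [Fin.sum_univ_succ, lL]
      simp [z2, z3, z4, z5]
      intro h; apply hne; linarith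
  refine ⟨A 0, ?_⟩
  funext x
  fin_cases x <;> simp [z2, z3, z4, z5]
  linarith

lemma specialL {F : XX aL bL → ℂ} (hF : NV F) (hS : Special F) :
    ∃ k : ℤ, Sim F (mono aL bL (k • (Pi.single 0 1 - Pi.single 1 1))) := by
  obtain ⟨A, hA⟩ := classify TrL hF
  obtain ⟨k, rfl⟩ := algL A (fun p q => by
    obtain ⟨c, c', hc, hP⟩ := hS _ _ (mono_nv aL bL (Pi.single p 1)) (mono_nv aL bL (Pi.single q 1))
    refine ⟨c, c', hc, fun x => ?_⟩
    obtain ⟨T, hT, hTp⟩ := mono_tori TrL x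
    simp only [mono_comb] at hP
    have := hP T hT _ _ _ _ (hA.per hT (hTp A)) (hTp _)
    simp only [lkL] at this
    convert this using 2
    · simp [Pi.single_apply]
    · simp [Pi.single_apply, add_mul, Finset.sum_add_distrib])
  exact ⟨k, hA⟩

lemma mainXX : IsEmpty (ContinuousMap.HomotopyEquiv (XX aL bL) (XX aM bM)) := by
  refine ⟨fun e => ?_⟩
  obtain ⟨u, hu⟩ : ∃ u : Fin 6 → ℤ, u = Pi.single 1 1 - Pi.single 2 1 := ⟨_, rfl⟩
  obtain ⟨v, hv⟩ : ∃ v : Fin 6 → ℤ, v = Pi.single 4 1 - Pi.single 5 1 := ⟨_, rfl⟩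
  have s1 : Special (mono aM bM u) := hu ▸ twin_special TrM (by decide) (by simp only [lkM]; decide)
  have s2 : Special (mono aM bM v) := hv ▸ twin_special TrM (by decide) (by simp only [lkM]; decide)
  have nv : ∀ w, NV (fun x => mono aM bM w (e.toFun x)) := fun w =>
    ⟨(mono_nv aM bM w).1.comp e.toFun.continuous, fun x => (mono_nv aM bM w).2 _⟩
  obtain ⟨k, hk⟩ := specialL (nv u) (s1.pull e)
  obtain ⟨l, hl⟩ := specialL (nv v) (s2.pull e)
  have back : ∀ w, Sim (fun x => mono aM bM w (e.toFun x)) (fun _ => 1) → w = 0 := by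
    intro w hw
    apply mono_sim_one TrM
    have t1 := hw.comp e.invFun.continuous
    have t2 := Sim.homotopic e.right_inv (mono_nv aM bM w)
    exact t2.trans t1
  have h1 := (hk.zpow l).mul (hl.zpow (-k))
  simp only [mono_comb] at h1
  have h2 := back _ (by
    convert h1 using 2 with p
    rw [← mono_zero aL bL p]
    congr 1
    module)
  have u1 : u 1 = 1 := by rw [hu]; decide
  have v1 : v 1 = 0 := by rw [hv]; decide
  have u4 : u 4 = 0 := by rw [hu]; decide
  have v4 : v 4 = 1 := by rw [hv]; decide
  have e1 := congrFun h2 4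
  simp [u4, v4] at e1
  subst e1
  have h3 := back u (by
    convert hk using 2 with p
    rw [← mono_zero aL bL p, zero_smul])
  rw [h3] at u1
  simp at u1

end Maz

/-- The complements of Mazurovskiĭ's arrangements `L` and `M` are not
homotopy equivalent. -/
theorem mazurovskii_L_M_not_homotopy_equivalent :
    IsEmpty (ContinuousMap.HomotopyEquiv
      {p : ℂ × ℂ | mazFL p.1 p.2 ≠ 0}
      {p : ℂ × ℂ | mazFM p.1 p.2 ≠ 0}) := by
  rw [Maz.setL, Maz.setM]
  exact Maz.mainXX
end

section
/- Let n ≥ 1 and let a_1 < a_2 < … < a_n be real numbers and b_1, …, b_n be pairwise distinct real numbers. For each i, let H_i = {(z, w) ∈ ℂ² : z − ((a_i + b_i)/2)·w − ((a_i − b_i)/2)·w̄ = 0}, regarded as a subset of ℝ⁴ under the identification ℂ² ≅ ℝ⁴. Then each H_i is a 2-dimensional real linear subspace of ℝ⁴, and H_i ∩ H_j = {0} for all i ≠ j; that is, the family H_1, …, H_n is a 2-arrangement of n planes in ℝ⁴. -/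
/-- The `ℝ`-linear map `ℂ² → ℂ`, `(z, w) ↦ z - α·w - β·w̄`. -/
noncomputable def horizMap (α β : ℂ) : (ℂ × ℂ) →ₗ[ℝ] ℂ where
  toFun p := p.1 - α * p.2 - β * (starRingEnd ℂ) p.2
  map_add' p q := by simp [map_add]; ring
  map_smul' c p := by
    simp [Complex.real_smul, Complex.conj_ofReal]
    ring

/-- The plane of the horizontal arrangement with slope data `(a, b)`:
the kernel of `(z, w) ↦ z - ((a+b)/2)·w - ((a-b)/2)·w̄`, viewed as a real
subspace of `ℂ² ≅ ℝ⁴`. -/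
noncomputable def horizPlane (a b : ℝ) : Submodule ℝ (ℂ × ℂ) :=
  LinearMap.ker (horizMap (((a + b) / 2 : ℝ) : ℂ) (((a - b) / 2 : ℝ) : ℂ))

theorem mem_horizPlane_iff (a b : ℝ) (p : ℂ × ℂ) :
    p ∈ horizPlane a b ↔ p.1.re = a * p.2.re ∧ p.1.im = b * p.2.im := by
  have h : p ∈ horizPlane a b ↔ p.1 - (((a + b) / 2 : ℝ) : ℂ) * p.2
      - (((a - b) / 2 : ℝ) : ℂ) * (starRingEnd ℂ) p.2 = 0 := Iff.rfl
  rw [h, Complex.ext_iff]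
  simp only [Complex.sub_re, Complex.sub_im, Complex.re_ofReal_mul, Complex.im_ofReal_mul,
    Complex.conj_re, Complex.conj_im, Complex.zero_re, Complex.zero_im]
  constructor
  · rintro ⟨h1, h2⟩
    constructor <;> linarith
  · rintro ⟨h1, h2⟩
    constructor <;> linarith

theorem finrank_horizPlane (a b : ℝ) : Module.finrank ℝ (horizPlane a b) = 2 := by
  have hs : Function.Surjective
      (horizMap (((a + b) / 2 : ℝ) : ℂ) (((a - b) / 2 : ℝ) : ℂ)) := by
    intro z
    exact ⟨(z, 0), by simp [horizMap]⟩
  have h := LinearMap.finrank_range_add_finrank_ker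
    (horizMap (((a + b) / 2 : ℝ) : ℂ) (((a - b) / 2 : ℝ) : ℂ))
  rw [LinearMap.range_eq_top.2 hs, finrank_top, Module.finrank_prod,
    Complex.finrank_real_complex] at h
  unfold horizPlane
  omega

/-- For `a_1 < ⋯ < a_n` and pairwise distinct `b_i`, the planes
`H_i = {z = ((a_i+b_i)/2)·w + ((a_i-b_i)/2)·w̄}` form a 2-arrangement of `n`
planes in `ℝ⁴`: each is a 2-dimensional real subspace, and they are pairwise
transverse. -/
theorem horizontal_is_two_arrangement (n : ℕ) (hn : 1 ≤ n) (a b : Fin n → ℝ)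
    (ha : StrictMono a) (hb : Function.Injective b) :
    (∀ i, Module.finrank ℝ (horizPlane (a i) (b i)) = 2) ∧
      ∀ i j, i ≠ j → horizPlane (a i) (b i) ⊓ horizPlane (a j) (b j) = ⊥ := by
  refine ⟨fun i => finrank_horizPlane _ _, fun i j hij => ?_⟩
  rw [eq_bot_iff]
  rintro p ⟨h1, h2⟩
  obtain ⟨h1, h1'⟩ := (mem_horizPlane_iff _ _ _).1 h1
  obtain ⟨h2, h2'⟩ := (mem_horizPlane_iff _ _ _).1 h2
  have e1 : (a i - a j) * p.2.re = 0 := by linarith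
  have e2 : (b i - b j) * p.2.im = 0 := by linarith
  have f1 : p.2.re = 0 :=
    (mul_eq_zero.1 e1).resolve_left (sub_ne_zero.2 (ha.injective.ne hij))
  have f2 : p.2.im = 0 := (mul_eq_zero.1 e2).resolve_left (sub_ne_zero.2 (hb.ne hij))
  rw [f1, mul_zero] at h1
  rw [f2, mul_zero] at h1'
  rw [Submodule.mem_bot]
  exact Prod.ext (Complex.ext h1 h1') (Complex.ext f1 f2)
end
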